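/- arXiv:1704.00319 — 4 statements merged into one kernel-verified Lean document; each statement's English description precedes it below -/
import Mathlib

section
/- Let 1 < p < ∞ and n ∈ ℕ, and let Z be a Banach space that uniformly contains the spaces ℓ_p^m, m ∈ ℕ. Then the set of n-tuples (x_1,…,x_n) ∈ (ℓ_p)^n for which the metric space {x_1,…,x_n} with the metric inherited from ℓ_p does not embed isometrically into Z is nowhere dense and Haar null in the Banach space (ℓ_p)^n. -/
open MeasureTheory
open scoped ENNReal
noncomputable section

/-- The index set of pairs `(i,j)` with `i < j`, indexing the coordinates of
`ℝ^{n(n-1)/2}`. -/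
abbrev PairIdx (n : ℕ) := {q : Fin n × Fin n // q.1 < q.2}

/-- `‖v‖_p` for `v ∈ ℝ^n`. -/
def pNorm (p : ℝ) {n : ℕ} (v : Fin n → ℝ) : ℝ := (∑ k, |v k| ^ p) ^ (1 / p)

/-- The map `F_n : (ℝ^n)^n → ℝ^{n(n-1)/2}`, `F_n(x₁,…,xₙ) = (‖x_i - x_j‖_p^p)_{i<j}`. -/
def Fmap (p : ℝ) (n : ℕ) (x : Fin n → Fin n → ℝ) : PairIdx n → ℝ :=
  fun q => ∑ k, |x q.val.1 k - x q.val.2 k| ^ p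

/-- `G_n`: the set of points of `(ℝ^n)^n` where the derivative of `F_n` has full rank
`n(n-1)/2`. -/
def Gset (p : ℝ) (n : ℕ) : Set (Fin n → Fin n → ℝ) :=
  {x | LinearMap.rank (fderiv ℝ (Fmap p n) x).toLinearMap = ((n * (n - 1) / 2 : ℕ) : Cardinal)}

/-- Property K for an `n`-tuple of points of `ℓ_p` (given by their coordinates). -/
def PropertyKSeq (p : ℝ) (n : ℕ) (x : Fin n → ℕ → ℝ) : Prop :=
  ∃ m : Fin n → ℕ, StrictMono m ∧ (fun i j => x i (m j)) ∈ Gset p n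

/-- Property K for an `n`-tuple of points of `ℓ_p^N`. -/
def PropertyKFin (p : ℝ) (n N : ℕ) (x : Fin n → Fin N → ℝ) : Prop :=
  ∃ m : Fin n → Fin N, StrictMono m ∧ (fun i j => x i (m j)) ∈ Gset p n

/-- A Borel set `A` in a (separable) Banach space is Haar null if there is a Borel
probability measure `μ` with `μ(x + A) = 0` for all `x`. -/
def HaarNull {X : Type*} [AddGroup X] [MeasurableSpace X] (A : Set X) : Prop :=
  ∃ μ : Measure X, IsProbabilityMeasure μ ∧ ∀ x : X, μ ((fun a => x + a) '' A) = 0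

/-- `X` uniformly contains the spaces `ℓ_p^m`, `m ∈ ℕ`. -/
def UnifContainsLp (p : ℝ≥0∞) [Fact (1 ≤ p)] (X : Type*) [NormedAddCommGroup X]
    [NormedSpace ℝ X] : Prop :=
  ∃ C : ℝ, 1 ≤ C ∧ ∀ m : ℕ, ∃ (Y : Submodule ℝ X)
    (T : PiLp p (fun _ : Fin m => ℝ) ≃L[ℝ] Y),
      ‖(T : PiLp p (fun _ : Fin m => ℝ) →L[ℝ] Y)‖ *
        ‖(T.symm : Y →L[ℝ] PiLp p (fun _ : Fin m => ℝ))‖ ≤ C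

-- test lp coercion and instances

section

open Filter Topology Finset

section ApproxNorms

variable {Z : Type*} [NormedAddCommGroup Z] [NormedSpace ℝ Z]
  {V W : Type*} [AddCommGroup V] [Module ℝ V] [AddCommGroup W] [Module ℝ W]

/-- The pointwise closure of the seminorms `v ↦ ‖T v‖`, where `T : V → Z` is linear. -/
def approxNorms (Z : Type*) [NormedAddCommGroup Z] [NormedSpace ℝ Z]
    (V : Type*) [AddCommGroup V] [Module ℝ V] : Set (V → ℝ) :=
  closure (Set.range fun (T : V →ₗ[ℝ] Z) (v : V) => ‖T v‖)

namespace approxNorms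

lemma of_isClosed {N : V → ℝ} (hN : N ∈ approxNorms Z V) (P : (V → ℝ) → Prop)
    (hP : IsClosed {N | P N}) (h : ∀ T : V →ₗ[ℝ] Z, P fun v => ‖T v‖) : P N :=
  closure_minimal (t := {N | P N}) (by rintro _ ⟨T, rfl⟩; exact h T) hP hN

lemma nonneg {N : V → ℝ} (hN : N ∈ approxNorms Z V) (v : V) : 0 ≤ N v :=
  of_isClosed hN (fun N => 0 ≤ N v) (isClosed_le continuous_const (continuous_apply v))
    fun _ => norm_nonneg _

lemma add_le {N : V → ℝ} (hN : N ∈ approxNorms Z V) (v w : V) : N (v + w) ≤ N v + N w :=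
  of_isClosed hN (fun N => N (v + w) ≤ N v + N w) (isClosed_le (by fun_prop) (by fun_prop))
    fun T => by simpa using norm_add_le _ _

lemma smul {N : V → ℝ} (hN : N ∈ approxNorms Z V) (c : ℝ) (v : V) : N (c • v) = |c| * N v :=
  of_isClosed hN (fun N => N (c • v) = |c| * N v) (isClosed_eq (by fun_prop) (by fun_prop))
    fun T => by simp [norm_smul]

lemma map_zero {N : V → ℝ} (hN : N ∈ approxNorms Z V) : N 0 = 0 := by
  simpa using smul hN 0 0

lemma sub_le {N : V → ℝ} (hN : N ∈ approxNorms Z V) (v w : V) : N v - N w ≤ N (v - w) := by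
  have := add_le hN (v - w) w
  rw [sub_add_cancel] at this; linarith

lemma neg {N : V → ℝ} (hN : N ∈ approxNorms Z V) (v : V) : N (-v) = N v := by
  simpa using smul hN (-1) v

lemma abs_sub_le {N : V → ℝ} (hN : N ∈ approxNorms Z V) (v w : V) :
    |N v - N w| ≤ N (v - w) := by
  rw [abs_le]
  have h1 := sub_le hN v w
  have h2 := sub_le hN w v
  rw [← neg hN (w - v), neg_sub] at h2
  constructor <;> linarith

lemma sum_le {N : V → ℝ} (hN : N ∈ approxNorms Z V) {ι : Type*} (s : Finset ι) (v : ι → V) :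
    N (∑ i ∈ s, v i) ≤ ∑ i ∈ s, N (v i) := by
  classical
  induction s using Finset.induction_on with
  | empty => simp [map_zero hN]
  | insert a s ha ih =>
    rw [sum_insert ha, sum_insert ha]
    exact (add_le hN _ _).trans (by linarith)

lemma of_tendsto {X : Type*} {l : Filter X} [l.NeBot] {N : X → V → ℝ} {N' : V → ℝ}
    (hN : ∀ᶠ x in l, N x ∈ approxNorms Z V) (h : Tendsto N l (𝓝 N')) :
    N' ∈ approxNorms Z V :=
  isClosed_closure.mem_of_tendsto h hN

lemma comp {N : W → ℝ} (hN : N ∈ approxNorms Z W) (L : V →ₗ[ℝ] W) :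
    (fun v => N (L v)) ∈ approxNorms Z V := by
  have hc : Continuous fun (N : W → ℝ) (v : V) => N (L v) := by fun_prop
  refine of_isClosed hN (fun N => (fun v => N (L v)) ∈ approxNorms Z V)
    (isClosed_closure.preimage hc) fun T => subset_closure ⟨T ∘ₗ L, rfl⟩

lemma const_mul {N : V → ℝ} (hN : N ∈ approxNorms Z V) {c : ℝ} (hc : 0 ≤ c) :
    (fun v => c * N v) ∈ approxNorms Z V := by
  have := comp hN (c • LinearMap.id)
  simpa [smul hN, abs_of_nonneg hc] using this

end approxNorms

end ApproxNorms

lemma Ultrafilter.exists_tendsto_of_eventually_mem_Icc {X : Type*} (U : Ultrafilter X)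
    {f : X → ℝ} {a b : ℝ} (h : ∀ᶠ x in (U : Filter X), f x ∈ Set.Icc a b) :
    ∃ y ∈ Set.Icc a b, Tendsto f U (𝓝 y) := by
  obtain ⟨y, hy, h'⟩ := isCompact_Icc.ultrafilter_le_nhds (U.map f) (le_principal_iff.2 h)
  exact ⟨y, hy, h'⟩

section PowSum

variable {α β ι : Type*}

/-- The `p`-th power of the `ℓ_p` norm of a finitely supported function. -/
def powSum (p : ℝ) (f : α →₀ ℝ) : ℝ := f.sum fun _ a => |a| ^ p

lemma powSum_nonneg (p : ℝ) (f : α →₀ ℝ) : 0 ≤ powSum p f :=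
  Finset.sum_nonneg fun _ _ => by positivity

lemma powSum_eq_sum {p : ℝ} (hp : 0 < p) (f : α →₀ ℝ) {s : Finset α} (hs : f.support ⊆ s) :
    powSum p f = ∑ a ∈ s, |f a| ^ p :=
  Finsupp.sum_of_support_subset _ hs _ fun _ _ => by simp [hp.ne']

lemma powSum_zero (p : ℝ) : powSum p (0 : α →₀ ℝ) = 0 := by simp [powSum]

lemma powSum_single {p : ℝ} (hp : 0 < p) (a : α) (c : ℝ) :
    powSum p (Finsupp.single a c) = |c| ^ p := by
  rw [powSum, Finsupp.sum_single_index]; simp [hp.ne']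

lemma powSum_add_single {p : ℝ} (hp : 0 < p) (f : α →₀ ℝ) {a : α} (ha : a ∉ f.support) (c : ℝ) :
    powSum p (f + Finsupp.single a c) = powSum p f + |c| ^ p := by
  classical
  rw [← powSum_single hp a c]
  refine Finsupp.sum_add_index_of_disjoint ?_ _
  exact Finset.disjoint_of_subset_right Finsupp.support_single_subset (by simpa using ha)

lemma sum_single_support_subset [DecidableEq ι] (s : Finset β) (e : β → ι) (c : β → ℝ) :
    (∑ b ∈ s, Finsupp.single (e b) (c b)).support ⊆ s.image e := by
  classical
  refine Finsupp.support_finsetSum.trans fun i hi => ?_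
  simp only [mem_biUnion, mem_image] at hi ⊢
  obtain ⟨b, hb, h⟩ := hi
  exact ⟨b, hb, (by simpa using Finsupp.support_single_subset h : i = e b).symm⟩

lemma powSum_sum_single {p : ℝ} (hp : 0 < p) (s : Finset β) (e : β → ι) (c : β → ℝ)
    (he : Set.InjOn e s) :
    powSum p (∑ b ∈ s, Finsupp.single (e b) (c b)) = ∑ b ∈ s, |c b| ^ p := by
  classical
  induction s using Finset.induction_on with
  | empty => simp [powSum_zero]
  | insert a s ha ih =>
    rw [sum_insert ha, sum_insert ha, add_comm, powSum_add_single hp, add_comm, ih]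
    · exact he.mono (by simp)
    · intro h
      obtain ⟨b, hb, hba⟩ := mem_image.1 (sum_single_support_subset s e c h)
      have : b = a := he (by simp [hb]) (by simp) hba
      exact ha (this ▸ hb)

lemma sum_single_apply_of_injOn (s : Finset β) (e : β → ι) (c : β → ℝ)
    (he : Set.InjOn e s) {b : β} (hb : b ∈ s) :
    (∑ b ∈ s, Finsupp.single (e b) (c b)) (e b) = c b := by
  classical
  rw [Finsupp.finsetSum_apply, sum_eq_single_of_mem b hb]
  · simp
  · intro b' hb' hne
    rw [Finsupp.single_apply, if_neg fun h => hne (he hb' hb h)]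

/-- `N` is `C`-equivalent to the `ℓ_p` norm on finitely supported functions. -/
def IsLpEquiv (p C : ℝ) (N : (α →₀ ℝ) → ℝ) : Prop :=
  ∀ f, powSum p f ^ (1 / p) ≤ N f ∧ N f ≤ C * powSum p f ^ (1 / p)

/-- `N` is invariant under order preserving changes of positions. -/
def IsSpreading [LinearOrder ι] (N : (ι →₀ ℝ) → ℝ) : Prop :=
  ∀ ⦃β : Type⦄ (s : Finset β) (c : β → ℝ) (e₁ e₂ : β → ι), Set.InjOn e₁ s →
    (∀ b ∈ s, ∀ b' ∈ s, e₁ b < e₁ b' ↔ e₂ b < e₂ b') →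
    N (∑ b ∈ s, Finsupp.single (e₁ b) (c b)) = N (∑ b ∈ s, Finsupp.single (e₂ b) (c b))

end PowSum

section Spreading

/-- The iterated limit over `s₁, …, s_k ∈ ℕ`, along a nonprincipal ultrafilter, of the values
`N (b + a₁ e_{s₁} + ⋯ + a_k e_{s_k})`. -/
def iterLim (N : (ℕ →₀ ℝ) → ℝ) : List ℝ → (ℕ →₀ ℝ) → ℝ
  | [], b => N b
  | a :: l, b => limUnder (hyperfilter ℕ : Filter ℕ)
      fun s => iterLim N l (b + Finsupp.single s a)

lemma exists_tendsto_iterLim {p : ℝ} (hp : 0 < p) (C : ℝ) {N : (ℕ →₀ ℝ) → ℝ} {l : List ℝ}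
    (h : ∀ b, iterLim N l b ∈ Set.Icc ((powSum p b + (l.map fun a => |a| ^ p).sum) ^ (1 / p))
      (C * (powSum p b + (l.map fun a => |a| ^ p).sum) ^ (1 / p))) (a : ℝ) (b : ℕ →₀ ℝ) :
    ∃ y ∈ Set.Icc ((powSum p b + ((a :: l).map fun a => |a| ^ p).sum) ^ (1 / p))
        (C * (powSum p b + ((a :: l).map fun a => |a| ^ p).sum) ^ (1 / p)),
      Tendsto (fun s => iterLim N l (b + Finsupp.single s a)) (hyperfilter ℕ : Filter ℕ) (𝓝 y) := by
  have hev : ∀ᶠ s in (hyperfilter ℕ : Filter ℕ), s ∉ b.support :=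
    hyperfilter_le_cofinite b.support.finite_toSet.compl_mem_cofinite
  refine Ultrafilter.exists_tendsto_of_eventually_mem_Icc _ ?_
  filter_upwards [hev] with s hs
  have := h (b + Finsupp.single s a)
  rw [powSum_add_single hp b hs] at this
  simpa [add_assoc] using this

lemma iterLim_mem_Icc {p C : ℝ} (hp : 0 < p) {N : (ℕ →₀ ℝ) → ℝ} (hN : IsLpEquiv p C N)
    (l : List ℝ) (b : ℕ →₀ ℝ) :
    iterLim N l b ∈ Set.Icc ((powSum p b + (l.map fun a => |a| ^ p).sum) ^ (1 / p))
      (C * (powSum p b + (l.map fun a => |a| ^ p).sum) ^ (1 / p)) := by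
  induction l generalizing b with
  | nil => simpa [iterLim] using hN b
  | cons a l ih =>
    obtain ⟨y, hy, hy'⟩ := exists_tendsto_iterLim hp C ih a b
    rw [iterLim, hy'.limUnder_eq]
    exact hy

lemma tendsto_iterLim {p C : ℝ} (hp : 0 < p) {N : (ℕ →₀ ℝ) → ℝ} (hN : IsLpEquiv p C N)
    (a : ℝ) (l : List ℝ) (b : ℕ →₀ ℝ) :
    Tendsto (fun s => iterLim N l (b + Finsupp.single s a)) (hyperfilter ℕ : Filter ℕ)
      (𝓝 (iterLim N (a :: l) b)) := by
  obtain ⟨y, -, hy⟩ := exists_tendsto_iterLim hp C (iterLim_mem_Icc hp hN l) a b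
  rwa [iterLim, hy.limUnder_eq]

lemma iterLim_filter_ne_zero (N : (ℕ →₀ ℝ) → ℝ) (l : List ℝ) (b : ℕ →₀ ℝ) :
    iterLim N (l.filter (· ≠ 0)) b = iterLim N l b := by
  induction l generalizing b with
  | nil => rfl
  | cons a l ih =>
    by_cases ha : a = 0
    · subst ha
      rw [List.filter_cons_of_neg (by simp), ih, iterLim]
      simpa using (tendsto_const_nhds (x := iterLim N l b)
        (f := (hyperfilter ℕ : Filter ℕ))).limUnder_eq.symm
    · rw [List.filter_cons_of_pos (by simpa using ha), iterLim, iterLim]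
      simp_rw [ih]

variable {Z : Type*} [NormedAddCommGroup Z] [NormedSpace ℝ Z]

lemma iterLim_mem_approxNorms {p C : ℝ} (hp : 0 < p) {N : (ℕ →₀ ℝ) → ℝ} (hN : IsLpEquiv p C N)
    (hZ : N ∈ approxNorms Z (ℕ →₀ ℝ)) {ι : Type*} (l : List ι) (B : (ι →₀ ℝ) →ₗ[ℝ] (ℕ →₀ ℝ)) :
    (fun f : ι →₀ ℝ => iterLim N (l.map f) (B f)) ∈ approxNorms Z (ι →₀ ℝ) := by
  induction l generalizing B with
  | nil => exact approxNorms.comp hZ B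
  | cons t l ih =>
    refine approxNorms.of_tendsto (l := (hyperfilter ℕ : Filter ℕ))
      (N := fun s (f : ι →₀ ℝ) =>
        iterLim N (l.map f) ((B + Finsupp.lsingle s ∘ₗ Finsupp.lapply t :
          (ι →₀ ℝ) →ₗ[ℝ] (ℕ →₀ ℝ)) f))
      (Eventually.of_forall fun s => ih _) ?_
    rw [tendsto_pi_nhds]
    intro f
    exact tendsto_iterLim hp hN (f t) (l.map f) (B f)

lemma exists_isSpreading {p C : ℝ} (hp : 0 < p) {N : (ℕ →₀ ℝ) → ℝ} (hN : IsLpEquiv p C N)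
    (hZ : N ∈ approxNorms Z (ℕ →₀ ℝ)) (ι : Type*) [LinearOrder ι] :
    ∃ N' ∈ approxNorms Z (ι →₀ ℝ), IsLpEquiv p C N' ∧ IsSpreading N' := by
  classical
  let M : (ι →₀ ℝ) → ℝ := fun f => iterLim N ((f.support.sort (· ≤ ·)).map f) 0
  have key (f : ι →₀ ℝ) (l : List ι) (hl : l.Pairwise (· < ·)) (hf : ∀ i ∈ f.support, i ∈ l) :
      iterLim N (l.map f) 0 = M f := by
    have : l.filter (fun i => f i ≠ 0) = f.support.sort (· ≤ ·) := by
      refine List.Perm.eq_of_pairwise (le := (· ≤ ·)) (fun a b _ _ => le_antisymm) ?_ ?_ ?_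
      · exact (hl.imp le_of_lt).sublist List.filter_sublist
      · exact Finset.pairwise_sort _ _
      · rw [List.perm_ext_iff_of_nodup]
        · intro a
          simp only [List.mem_filter, Finset.mem_sort]
          constructor
          · rintro ⟨_, h⟩; simpa using h
          · intro h; exact ⟨hf a h, by simpa using h⟩
        · exact (hl.imp ne_of_lt).sublist List.filter_sublist
        · exact Finset.sort_nodup _ _
    simp only [M]
    rw [← this, ← iterLim_filter_ne_zero N (l.map f), List.filter_map]
    rfl
  refine ⟨M, ?_, ?_, ?_⟩
  · refine approxNorms.of_tendsto (l := (atTop : Filter (Finset ι)))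
      (N := fun F (f : ι →₀ ℝ) =>
        iterLim N ((F.sort (· ≤ ·)).map f) ((0 : (ι →₀ ℝ) →ₗ[ℝ] (ℕ →₀ ℝ)) f))
      (Eventually.of_forall fun s => iterLim_mem_approxNorms hp hN hZ _ _) ?_
    rw [tendsto_pi_nhds]
    intro f
    refine tendsto_const_nhds.congr' ?_
    filter_upwards [eventually_ge_atTop f.support] with F hF
    exact (key f _ (Finset.sortedLT_sort F).pairwise fun i hi => by simpa using hF hi).symm
  · intro f
    have := iterLim_mem_Icc hp hN ((f.support.sort (· ≤ ·)).map f) 0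
    have h2 : (((f.support.sort (· ≤ ·)).map f).map fun a => |a| ^ p).sum = powSum p f := by
      rw [List.map_map, ((Finset.sort_perm_toList f.support _).map _).sum_eq, Finset.sum_map_toList]
      rfl
    rwa [h2, powSum_zero, zero_add] at this
  · intro β s c e₁ e₂ he₁ h
    have he₂ : Set.InjOn e₂ s := by
      intro a ha b hb hab
      refine he₁ ha hb (le_antisymm ?_ ?_) <;> rw [← not_lt, h _ (by assumption) _ (by assumption)]
        <;> simp [hab]
    obtain ⟨l, hl, hls⟩ : ∃ l : List β, l.Pairwise (fun a b => e₁ a < e₁ b) ∧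
        ∀ b, b ∈ l ↔ b ∈ s := by
      rcases isEmpty_or_nonempty β with hβ | hβ
      · exact ⟨[], List.Pairwise.nil, fun b => hβ.elim b⟩
      have hinv : ∀ i ∈ s.image e₁, Function.invFunOn e₁ s i ∈ (s : Set β) ∧
          e₁ (Function.invFunOn e₁ s i) = i := fun i hi => by
        have : ∃ b ∈ (s : Set β), e₁ b = i := by simpa using hi
        exact ⟨Function.invFunOn_mem this, Function.invFunOn_eq this⟩
      refine ⟨((s.image e₁).sort (· ≤ ·)).map (Function.invFunOn e₁ s), ?_, ?_⟩
      · rw [List.pairwise_map]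
        refine (Finset.sortedLT_sort (s.image e₁)).pairwise.imp_of_mem fun ha hb hab => ?_
        rw [(hinv _ (by simpa using ha)).2, (hinv _ (by simpa using hb)).2]
        exact hab
      · intro b
        simp only [List.mem_map, Finset.mem_sort]
        constructor
        · rintro ⟨i, hi, rfl⟩; exact (hinv i hi).1
        · intro hb
          have hi : e₁ b ∈ s.image e₁ := mem_image_of_mem _ hb
          exact ⟨e₁ b, hi, he₁ (hinv _ hi).1 hb (hinv _ hi).2⟩
    have main (e : β → ι) (he : Set.InjOn e s) (hle : l.Pairwise (fun a b => e a < e b)) :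
        iterLim N (l.map c) 0 = M (∑ b ∈ s, Finsupp.single (e b) (c b)) := by
      rw [← key _ (l.map e) (by rwa [List.pairwise_map])]
      · rw [List.map_map]
        congr 1
        refine List.map_congr_left fun b hb => ?_
        exact (sum_single_apply_of_injOn s e c he ((hls b).1 hb)).symm
      · intro i hi
        obtain ⟨b, hb, rfl⟩ := mem_image.1 (sum_single_support_subset s e c hi)
        exact List.mem_map_of_mem ((hls b).2 hb)
    rw [← main e₁ he₁ hl, ← main e₂ he₂]
    exact hl.imp_of_mem fun {a b} ha hb hab => (h a ((hls a).1 ha) b ((hls b).1 hb)).1 hab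

end Spreading

section InitialNorm

variable {Z : Type*} [NormedAddCommGroup Z] [NormedSpace ℝ Z]

lemma exists_isLpEquiv_of_unifContainsLp {p : ℝ} (hp : 1 < p) [Fact (1 ≤ ENNReal.ofReal p)]
    (hZ : UnifContainsLp (ENNReal.ofReal p) Z) :
    ∃ C, ∃ N ∈ approxNorms Z (ℕ →₀ ℝ), IsLpEquiv p C N := by
  have hp0 : 0 < p := by linarith
  obtain ⟨C, -, h⟩ := hZ
  choose Y T hT using h
  let R (m : ℕ) : (ℕ →₀ ℝ) →ₗ[ℝ] PiLp (ENNReal.ofReal p) (fun _ : Fin m => ℝ) :=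
    (WithLp.linearEquiv (ENNReal.ofReal p) ℝ (Fin m → ℝ)).symm.toLinearMap ∘ₗ
      LinearMap.pi fun i : Fin m => Finsupp.lapply (i : ℕ)
  have hR (f : ℕ →₀ ℝ) (m : ℕ) (hm : f.support ⊆ range m) :
      ‖R m f‖ = powSum p f ^ (1 / p) := by
    rw [PiLp.norm_eq_sum (by rw [ENNReal.toReal_ofReal hp0.le]; exact hp0),
      ENNReal.toReal_ofReal hp0.le, powSum_eq_sum hp0 f hm, Finset.sum_range]
    rfl
  let N (m : ℕ) (f : ℕ →₀ ℝ) : ℝ :=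
    ‖((T m).symm : Y m →L[ℝ] PiLp (ENNReal.ofReal p) (fun _ : Fin m => ℝ))‖ *
      ‖(Y m).subtype (T m (R m f))‖
  have hN (m : ℕ) : N m ∈ approxNorms Z (ℕ →₀ ℝ) :=
    approxNorms.const_mul (N := fun f => ‖(Y m).subtype (T m (R m f))‖)
      (subset_closure ⟨(Y m).subtype ∘ₗ (T m).toLinearEquiv.toLinearMap ∘ₗ R m, rfl⟩)
      (ContinuousLinearMap.opNorm_nonneg _)
  have hb (f : ℕ →₀ ℝ) : ∀ᶠ m in (hyperfilter ℕ : Filter ℕ),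
      N m f ∈ Set.Icc (powSum p f ^ (1 / p)) (C * powSum p f ^ (1 / p)) := by
    have h1 : ∀ᶠ m in (hyperfilter ℕ : Filter ℕ), f.support ⊆ range m := by
      refine Nat.hyperfilter_le_atTop ?_
      filter_upwards [eventually_gt_atTop (f.support.sup id)] with m hm i hi
      exact mem_range.2 ((Finset.le_sup (f := id) hi).trans_lt hm)
    filter_upwards [h1] with m hm
    rw [← hR f m hm]
    constructor
    · have := ((T m).symm : Y m →L[ℝ] PiLp (ENNReal.ofReal p) (fun _ : Fin m => ℝ)).le_opNorm
        (T m (R m f))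
      simpa [N] using this
    · have := (T m : _ →L[ℝ] Y m).le_opNorm (R m f)
      calc N m f ≤ _ * (_ * ‖R m f‖) := 
            mul_le_mul_of_nonneg_left this (ContinuousLinearMap.opNorm_nonneg _)
        _ = _ * ‖R m f‖ := by rw [← mul_assoc, mul_comm ‖_‖ ‖_‖]
        _ ≤ C * ‖R m f‖ := mul_le_mul_of_nonneg_right (hT m) (norm_nonneg _)
  choose N' hN' hlim using fun f => Ultrafilter.exists_tendsto_of_eventually_mem_Icc _ (hb f)
  exact ⟨C, N', approxNorms.of_tendsto (Eventually.of_forall hN) (tendsto_pi_nhds.2 hlim), hN'⟩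

end InitialNorm

section SignInvariant

/-- `N` does not depend on the signs of the coefficients. -/
def IsSignInvariant {ι : Type*} (N : (ι →₀ ℝ) → ℝ) : Prop :=
  ∀ ⦃β : Type⦄ (s : Finset β) (c c' : β → ℝ) (e : β → ι), Set.InjOn e s →
    (∀ b ∈ s, |c b| = |c' b|) →
    N (∑ b ∈ s, Finsupp.single (e b) (c b)) = N (∑ b ∈ s, Finsupp.single (e b) (c' b))

/-- The linear map replacing `e_t` by the alternating sum `∑_{j < L} (-1)^j e_{(t, j)}`. -/
def alternatingBlock (ι : Type*) (L : ℕ) : (ι →₀ ℝ) →ₗ[ℝ] (ι ×ₗ ℕ →₀ ℝ) :=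
  Finsupp.linearCombination ℝ fun t => ∑ j ∈ range L, Finsupp.single (toLex (t, j)) ((-1) ^ j)

lemma alternatingBlock_sum_single {ι β : Type*} (L : ℕ) (s : Finset β) (e : β → ι) (c : β → ℝ) :
    alternatingBlock ι L (∑ b ∈ s, Finsupp.single (e b) (c b)) =
      ∑ x ∈ s ×ˢ range L, Finsupp.single (toLex (e x.1, x.2)) (c x.1 * (-1) ^ x.2) := by
  rw [map_sum, sum_product]
  refine sum_congr rfl fun b _ => ?_
  rw [alternatingBlock, Finsupp.linearCombination_single, smul_sum]
  simp

lemma injOn_toLex_prod {ι β : Type*} {s : Finset β} {e : β → ι} (he : Set.InjOn e s)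
    (σ : β → ℕ) (t : Finset ℕ) :
    Set.InjOn (fun x : β × ℕ => toLex (e x.1, x.2 + σ x.1))
      ((s ×ˢ t : Finset (β × ℕ)) : Set _) := by
  rintro ⟨b, j⟩ hb ⟨b', j'⟩ hb' h
  simp only [coe_product, Set.mem_prod, mem_coe, EmbeddingLike.apply_eq_iff_eq,
    Prod.mk.injEq] at hb hb' h
  obtain rfl := he hb.1 hb'.1 h.1
  simpa using h.2

lemma powSum_alternatingBlock {p : ℝ} (hp : 0 < p) {ι : Type*} (L : ℕ) (f : ι →₀ ℝ) :
    powSum p (alternatingBlock ι L f) = L * powSum p f := by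
  conv_lhs => rw [← f.sum_single, Finsupp.sum, alternatingBlock_sum_single]
  rw [powSum_sum_single hp _ _ _ (by simp), sum_product, powSum, Finsupp.sum, mul_sum]
  simp [abs_mul]

lemma abs_alternatingBlock_sub_le {Z : Type*} [NormedAddCommGroup Z] [NormedSpace ℝ Z]
    {p C : ℝ} (hp : 0 < p) {ι β : Type} [LinearOrder ι] {N : (ι ×ₗ ℕ →₀ ℝ) → ℝ}
    (hN : N ∈ approxNorms Z (ι ×ₗ ℕ →₀ ℝ)) (hC : IsLpEquiv p C N) (hs : IsSpreading N) (L : ℕ)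
    (s : Finset β) (c c' : β → ℝ) (e : β → ι) (he : Set.InjOn e s)
    (hc : ∀ b ∈ s, |c b| = |c' b|) :
    |N (alternatingBlock ι L (∑ b ∈ s, Finsupp.single (e b) (c' b))) -
      N (alternatingBlock ι L (∑ b ∈ s, Finsupp.single (e b) (c b)))| ≤
      ∑ b ∈ s, 2 * C * |c b| := by
  classical
  let σ : β → ℕ := fun b => if c' b = c b then 0 else 1
  have hsingle (i : ι ×ₗ ℕ) (a : ℝ) : N (Finsupp.single i a) ≤ C * |a| := by
    have := (hC (Finsupp.single i a)).2
    rwa [powSum_single hp, one_div, Real.rpow_rpow_inv (abs_nonneg _) hp.ne'] at this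
  rw [alternatingBlock_sum_single, alternatingBlock_sum_single,
    hs (s ×ˢ range L) _ (fun x => toLex (e x.1, x.2)) (fun x => toLex (e x.1, x.2 + σ x.1))
      (by simpa using injOn_toLex_prod he 0 (range L))]
  swap
  · rintro ⟨b, j⟩ hb ⟨b', j'⟩ hb'
    simp only [mem_product] at hb hb'
    simp only [Prod.Lex.toLex_lt_toLex]
    by_cases h : e b = e b'
    · obtain rfl := he hb.1 hb'.1 h
      simp
    · simp [h]
  refine (approxNorms.abs_sub_le hN _ _).trans ?_
  rw [sum_product, sum_product, ← sum_sub_distrib]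
  refine (approxNorms.sum_le hN _ _).trans (sum_le_sum fun b hb => ?_)
  have hC0 : 0 ≤ C * |c b| := (approxNorms.nonneg hN _).trans (hsingle (toLex (e b, 0)) (c b))
  by_cases h : c' b = c b
  · simp only [σ, h]
    simp [approxNorms.map_zero hN]
    linarith
  · have h' : c' b = - c b := by
      rcases abs_eq_abs.1 (hc b hb) with h1 | h1
      · exact absurd h1.symm h
      · rw [h1, neg_neg]
    have : (∑ j ∈ range L, Finsupp.single (toLex (e b, j + σ b)) (c' b * (-1) ^ j) -
        ∑ j ∈ range L, Finsupp.single (toLex (e b, j)) (c b * (-1) ^ j) : ι ×ₗ ℕ →₀ ℝ) =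
        Finsupp.single (toLex (e b, L)) (c b * (-1) ^ L) -
          Finsupp.single (toLex (e b, 0)) (c b * (-1) ^ 0) := by
      rw [← sum_sub_distrib,
        ← sum_range_sub (fun j => Finsupp.single (toLex (e b, j)) (c b * (-1) ^ j))]
      refine sum_congr rfl fun j _ => ?_
      have hσ : σ b = 1 := by simp [σ, h]
      rw [hσ, h', pow_succ]
      simp
    rw [this, sub_eq_add_neg]
    refine (approxNorms.add_le hN _ _).trans ?_
    rw [approxNorms.neg hN]
    have h1 := hsingle (toLex (e b, L)) (c b * (-1) ^ L)
    have h2 := hsingle (toLex (e b, 0)) (c b * (-1) ^ 0)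
    simp only [abs_mul, abs_pow, abs_neg, abs_one, one_pow, mul_one] at h1 h2
    linarith

lemma exists_isSignInvariant {Z : Type*} [NormedAddCommGroup Z] [NormedSpace ℝ Z]
    {p C : ℝ} (hp : 0 < p) {ι : Type} [LinearOrder ι] {N : (ι ×ₗ ℕ →₀ ℝ) → ℝ}
    (hN : N ∈ approxNorms Z (ι ×ₗ ℕ →₀ ℝ)) (hC : IsLpEquiv p C N) (hs : IsSpreading N) :
    ∃ N' ∈ approxNorms Z (ι →₀ ℝ), IsLpEquiv p C N' ∧ IsSpreading N' ∧ IsSignInvariant N' := by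
  let M (L : ℕ) (f : ι →₀ ℝ) : ℝ := ((L : ℝ) ^ (1 / p))⁻¹ * N (alternatingBlock ι L f)
  have hM (L : ℕ) : M L ∈ approxNorms Z (ι →₀ ℝ) :=
    approxNorms.const_mul (approxNorms.comp hN _) (by positivity)
  have hb (f : ι →₀ ℝ) : ∀ᶠ L in (hyperfilter ℕ : Filter ℕ),
      M L f ∈ Set.Icc (powSum p f ^ (1 / p)) (C * powSum p f ^ (1 / p)) := by
    filter_upwards [Nat.hyperfilter_le_atTop (eventually_gt_atTop 0)] with L hL
    have h1 : (0 : ℝ) < (L : ℝ) ^ (1 / p) := by positivity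
    have := hC (alternatingBlock ι L f)
    rw [powSum_alternatingBlock hp, Real.mul_rpow (by positivity) (powSum_nonneg _ _)] at this
    constructor
    · rw [← div_le_iff₀' (by positivity), div_inv_eq_mul, mul_comm]; exact this.1
    · rw [inv_mul_le_iff₀ h1]; linarith [this.2]
  choose N' hN' hlim using fun f => Ultrafilter.exists_tendsto_of_eventually_mem_Icc _ (hb f)
  refine ⟨N', approxNorms.of_tendsto (Eventually.of_forall hM) (tendsto_pi_nhds.2 hlim), hN',
    ?_, ?_⟩
  · intro β s c e₁ e₂ he h
    refine tendsto_nhds_unique (hlim _) ((hlim _).congr fun L => ?_)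
    simp only [M, alternatingBlock_sum_single]
    congr 1
    symm
    refine hs _ _ _ _ (by simpa using injOn_toLex_prod he 0 (range L)) ?_
    rintro ⟨b, j⟩ hb ⟨b', j'⟩ hb'
    simp only [mem_product] at hb hb'
    simp only [Prod.Lex.toLex_lt_toLex, h b hb.1 b' hb'.1]
    have h1 := h b hb.1 b' hb'.1
    have h2 := h b' hb'.1 b hb.1
    have : e₁ b = e₁ b' ↔ e₂ b = e₂ b' := by
      simp only [le_antisymm_iff, ← not_lt, h1, h2]
    simp only [this]
  · intro β s c c' e he hc
    have h0 : Tendsto (fun L : ℕ => ((L : ℝ) ^ (1 / p))⁻¹ * ∑ b ∈ s, 2 * C * |c b|)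
        (hyperfilter ℕ : Filter ℕ) (𝓝 0) := by
      have h1 := (tendsto_rpow_atTop (show 0 < 1 / p by positivity)).comp
        (tendsto_natCast_atTop_atTop (R := ℝ))
      have := (h1.inv_tendsto_atTop.mul_const (∑ b ∈ s, 2 * C * |c b|)).mono_left
        Nat.hyperfilter_le_atTop
      simpa using this
    have h2 : Tendsto (fun L => M L (∑ b ∈ s, Finsupp.single (e b) (c' b)) -
        M L (∑ b ∈ s, Finsupp.single (e b) (c b))) (hyperfilter ℕ : Filter ℕ) (𝓝 0) := by
      refine squeeze_zero_norm (fun L => ?_) h0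
      simp only [M, ← mul_sub, Real.norm_eq_abs, abs_mul]
      rw [abs_of_nonneg (by positivity)]
      exact mul_le_mul_of_nonneg_left (abs_alternatingBlock_sub_le hp hN hC hs L s c c' e he hc)
        (by positivity)
    have h3 := (hlim (∑ b ∈ s, Finsupp.single (e b) (c' b))).sub h2
    simp only [sub_sub_cancel, sub_zero] at h3
    exact tendsto_nhds_unique (hlim _) h3

end SignInvariant

section Folner

lemma exists_folner (K : ℕ) {η : ℝ} (hη : 0 < η) :
    ∃ Φ : Finset ℕ, Φ.Nonempty ∧ (∀ m ∈ Φ, 0 < m) ∧ ∀ k, 0 < k → k ≤ K →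
      (#(Φ \ Φ.image (k * ·)) : ℝ) ≤ η * #Φ ∧ (#(Φ.image (k * ·) \ Φ) : ℝ) ≤ η * #Φ := by
  let Ψ (N : ℕ) : Finset ℕ :=
    (Fintype.piFinset fun _ : Fin K => range (N + 1)).image
      fun a : Fin K → ℕ => ∏ i : Fin K, ((i : ℕ) + 1) ^ a i
  have hcard (N : ℕ) : #(Ψ N) ≤ (N + 1) ^ K := by
    refine card_image_le.trans ?_
    simp
  have hmono (N : ℕ) : Ψ N ⊆ Ψ (N + 1) := by
    refine image_subset_image fun a ha => ?_
    simp only [Fintype.mem_piFinset, mem_range] at ha ⊢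
    exact fun i => (ha i).trans (by omega)
  have hmul (N k : ℕ) (hk : 0 < k) (hK : k ≤ K) : (Ψ N).image (k * ·) ⊆ Ψ (N + 1) := by
    intro x hx
    simp only [Ψ, mem_image, Fintype.mem_piFinset, mem_range] at hx ⊢
    obtain ⟨_, ⟨a, ha, rfl⟩, rfl⟩ := hx
    let i₀ : Fin K := ⟨k - 1, by omega⟩
    refine ⟨Function.update a i₀ (a i₀ + 1), fun i => ?_, ?_⟩
    · by_cases h : i = i₀
      · have := ha i; simp only [h, Function.update_self] at this ⊢; omega
      · have := ha i; rw [Function.update_of_ne h]; omega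
    · rw [← mul_prod_erase _ _ (mem_univ i₀),
        ← mul_prod_erase univ (fun i : Fin K => ((i : ℕ) + 1) ^ a i)
        (mem_univ i₀), Function.update_self, pow_succ]
      have hk' : (i₀ : ℕ) + 1 = k := by simp only [i₀]; omega
      rw [hk', ← mul_assoc, mul_comm k]
      congr 1
      refine prod_congr rfl fun i hi => ?_
      rw [Function.update_of_ne (ne_of_mem_erase hi)]
  have hne (N : ℕ) : (Ψ N).Nonempty :=
    Finset.Nonempty.image ⟨0, by simp⟩ _
  obtain ⟨N, hN⟩ : ∃ N, (#(Ψ (N + 1)) : ℝ) ≤ (1 + η) * #(Ψ N) := by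
    by_contra! h
    have hge (N : ℕ) : (1 + η) ^ N ≤ #(Ψ N) := by
      induction N with
      | zero => simpa using (hne 0).card_pos
      | succ N ih =>
        rw [pow_succ']
        exact (mul_le_mul_of_nonneg_left ih (by positivity)).trans (h N).le
    have hlim := (tendsto_pow_const_div_const_pow_of_one_lt K
      (show 1 < 1 + η by linarith)).comp (tendsto_add_atTop_nat 1)
    obtain ⟨N, hN⟩ := (hlim.eventually_lt_const (show 0 < (1 + η)⁻¹ by positivity)).exists
    have h1 : (1 + η) ^ N ≤ ((N : ℝ) + 1) ^ K := (hge N).trans (by exact_mod_cast hcard N)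
    simp only [Function.comp_apply, Nat.cast_add, Nat.cast_one] at hN
    rw [div_lt_iff₀ (by positivity), pow_succ', inv_mul_cancel_left₀ (by positivity)] at hN
    linarith
  have hpos : ∀ m ∈ Ψ N, 0 < m := by
    intro m hm
    obtain ⟨a, -, rfl⟩ := mem_image.1 hm
    exact prod_pos fun i _ => by positivity
  refine ⟨Ψ N, hne N, hpos, fun k hk hK => ?_⟩
  have h1 : #((Ψ N).image (k * ·)) = #(Ψ N) :=
    card_image_of_injective _ fun a b h => Nat.eq_of_mul_eq_mul_left hk h
  have h2 : #(Ψ N \ (Ψ N).image (k * ·)) = #((Ψ N).image (k * ·) \ Ψ N) :=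
    card_sdiff_comm h1.symm
  have h3 : (#((Ψ N).image (k * ·) \ Ψ N) : ℝ) ≤ η * #(Ψ N) := by
    have h4 : #((Ψ N).image (k * ·) \ Ψ N) ≤ #(Ψ (N + 1) \ Ψ N) :=
      card_le_card (sdiff_subset_sdiff (hmul N k hk hK) le_rfl)
    have h5 : (#(Ψ (N + 1) \ Ψ N) : ℝ) = #(Ψ (N + 1)) - #(Ψ N) := by
      rw [card_sdiff_of_subset (hmono N), Nat.cast_sub (card_le_card (hmono N))]
    have h6 : (#((Ψ N).image (k * ·) \ Ψ N) : ℝ) ≤ #(Ψ (N + 1) \ Ψ N) := by exact_mod_cast h4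
    linarith
  exact ⟨by rw [h2]; exact h3, h3⟩

end Folner

lemma sum_range_sum_range_offset {M : Type*} [AddCommMonoid M] (n : ℕ → ℕ) (r : ℕ) (G : ℕ → M) :
    ∑ i ∈ range r, ∑ j ∈ range (n i), G (∑ i' ∈ range i, n i' + j) =
      ∑ J ∈ range (∑ i ∈ range r, n i), G J := by
  induction r with
  | zero => simp
  | succ r ih => rw [sum_range_succ, ih, sum_range_succ, sum_range_add]

section KrivineVector

/-- The vector `m^{-1/p} ∑_{i < m} e_{(q + i) / m}`. -/
def uniformVector (p q : ℝ) (m : ℕ) : ℝ →₀ ℝ :=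
  ∑ i ∈ range m, Finsupp.single ((q + i) / m) (((m : ℝ) ^ (1 / p))⁻¹)

/-- The sum of the vectors `uniformVector p q m` over `m ∈ Φ`. -/
def krivineVector (p q : ℝ) (Φ : Finset ℕ) : ℝ →₀ ℝ := ∑ m ∈ Φ, uniformVector p q m

lemma krivineVector_eq (p q : ℝ) (Φ : Finset ℕ) :
    krivineVector p q Φ = ∑ x ∈ Φ.sigma range,
      Finsupp.single ((q + (x.2 : ℕ)) / (x.1 : ℕ)) ((((x.1 : ℕ) : ℝ) ^ (1 / p))⁻¹) := by
  rw [sum_sigma]; rfl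

lemma injOn_krivine {q : ℝ} (hq : Irrational q) {Φ : Finset ℕ} (hΦ : ∀ m ∈ Φ, 0 < m) :
    Set.InjOn (fun x : (_ : ℕ) × ℕ => (q + (x.2 : ℕ)) / (x.1 : ℕ))
      (Φ.sigma range : Finset ((_ : ℕ) × ℕ)) := by
  rintro ⟨m, i⟩ hm ⟨m', i'⟩ hm' h
  simp only [coe_sigma, Set.mem_sigma_iff, mem_coe] at hm hm' h
  have h1 : (0 : ℝ) < m := by exact_mod_cast hΦ m hm.1
  have h2 : (0 : ℝ) < m' := by exact_mod_cast hΦ m' hm'.1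
  rw [div_eq_div_iff h1.ne' h2.ne'] at h
  have hmm : m = m' := by
    by_contra hne
    have h3 : ((m' : ℝ) - m) ≠ 0 := by
      rw [sub_ne_zero]; exact_mod_cast Ne.symm hne
    refine hq ⟨((i' * m - i * m' : ℤ) : ℚ) / ((m' - m : ℤ) : ℚ), ?_⟩
    push_cast
    rw [div_eq_iff h3]
    linarith
  subst hmm
  have : (i : ℝ) = i' := by
    have := mul_right_cancel₀ h1.ne' h
    linarith
  simpa using this

lemma powSum_krivineVector {p q : ℝ} (hp : 0 < p) (hq : Irrational q) {Φ : Finset ℕ}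
    (hΦ : ∀ m ∈ Φ, 0 < m) : powSum p (krivineVector p q Φ) = #Φ := by
  rw [krivineVector_eq, powSum_sum_single hp _ _ _ (injOn_krivine hq hΦ), sum_sigma]
  have (m) (hm : m ∈ Φ) : ∑ _i ∈ range m, |((m : ℝ) ^ (1 / p))⁻¹| ^ p = 1 := by
    have h1 : (0 : ℝ) < m := by exact_mod_cast hΦ m hm
    rw [abs_of_nonneg (by positivity), sum_const, card_range, Real.inv_rpow (by positivity),
      one_div,
      Real.rpow_inv_rpow h1.le hp.ne', nsmul_eq_mul, mul_inv_cancel₀ h1.ne']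
  rw [sum_congr rfl this]
  simp

lemma krivineVector_support {p q : ℝ} (hq0 : 0 < q) (hq1 : q < 1) (Φ : Finset ℕ) {x : ℝ}
    (hx : x ∈ (krivineVector p q Φ).support) : x ∈ Set.Ioo (0 : ℝ) 1 := by
  classical
  rw [krivineVector_eq] at hx
  obtain ⟨⟨m, i⟩, h, rfl⟩ := mem_image.1 (sum_single_support_subset _ _ _ hx)
  simp only [mem_sigma, mem_range] at h
  have h1 : (0 : ℝ) < m := by exact_mod_cast (by omega : 0 < m)
  have h2 : (i : ℝ) + 1 ≤ m := by exact_mod_cast h.2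
  constructor
  · simp only; positivity
  · simp only; rw [div_lt_one h1]; linarith

lemma krivineVector_sub (p q : ℝ) (Φ Ψ : Finset ℕ) :
    krivineVector p q Φ - krivineVector p q Ψ =
      krivineVector p q (Φ \ Ψ) - krivineVector p q (Ψ \ Φ) :=
  (sum_sdiff_sub_sum_sdiff ..).symm

lemma sum_mapDomain_uniformVector {p : ℝ} (q : ℝ) {k m : ℕ} (hk : 0 < k)
    (hm : 0 < m) :
    ∑ j ∈ range k, (uniformVector p q m).mapDomain (fun x : ℝ => (x + (j : ℝ)) / (k : ℝ)) =
      (k : ℝ) ^ (1 / p) • uniformVector p q (k * m) := by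
  have hk' : (0 : ℝ) < k := by exact_mod_cast hk
  have hm' : (0 : ℝ) < m := by exact_mod_cast hm
  have h := sum_range_sum_range_offset (fun _ => m) k fun J =>
    Finsupp.single ((q + J) / ((k * m : ℕ) : ℝ)) (((m : ℝ) ^ (1 / p))⁻¹)
  simp only [sum_const, card_range, smul_eq_mul] at h
  conv_rhs => rw [uniformVector, smul_sum]
  convert h using 1
  · refine sum_congr rfl fun j _ => ?_
    rw [uniformVector, Finsupp.mapDomain_finsetSum]
    refine sum_congr rfl fun i _ => ?_
    rw [Finsupp.mapDomain_single]
    congr 1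
    push_cast
    field_simp
    ring
  · refine sum_congr rfl fun j _ => ?_
    rw [Finsupp.smul_single, Nat.cast_mul, Real.mul_rpow hk'.le hm'.le, smul_eq_mul, mul_inv,
      mul_inv_cancel_left₀ (by positivity)]

lemma sum_mapDomain_krivineVector {p : ℝ} (q : ℝ) {k : ℕ} (hk : 0 < k) {Φ : Finset ℕ}
    (hΦ : ∀ m ∈ Φ, 0 < m) :
    ∑ j ∈ range k, (krivineVector p q Φ).mapDomain (fun x : ℝ => (x + (j : ℝ)) / (k : ℝ)) =
      (k : ℝ) ^ (1 / p) • krivineVector p q (Φ.image (k * ·)) := by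
  simp only [krivineVector, Finsupp.mapDomain_finsetSum]
  rw [sum_comm, sum_image fun a _ b _ h => Nat.eq_of_mul_eq_mul_left hk h, smul_sum]
  exact sum_congr rfl fun m hm => sum_mapDomain_uniformVector q hk (hΦ m hm)

variable {Z : Type*} [NormedAddCommGroup Z] [NormedSpace ℝ Z] {N : (ℝ →₀ ℝ) → ℝ} {p C q : ℝ}

lemma IsSpreading.mapDomain (hs : IsSpreading N) {g : ℝ → ℝ} (hg : StrictMono g) (f : ℝ →₀ ℝ) :
    N (f.mapDomain g) = N f := by
  conv_rhs => rw [← f.sum_single, Finsupp.sum]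
  exact hs _ _ _ _ hg.injective.injOn fun b _ b' _ => hg.lt_iff_lt

lemma smul_sub_sum_mapDomain_le (hN : N ∈ approxNorms Z (ℝ →₀ ℝ)) (hp : 0 < p)
    (hC : IsLpEquiv p C N) (hC0 : 0 ≤ C) (hq : Irrational q) {Φ : Finset ℕ}
    (hΦ : ∀ m ∈ Φ, 0 < m) {k : ℕ} {η : ℝ}
    (h : 0 < k → (#(Φ \ Φ.image (k * ·)) : ℝ) ≤ η * #Φ ∧ (#(Φ.image (k * ·) \ Φ) : ℝ) ≤ η * #Φ) :
    N ((k : ℝ) ^ (1 / p) • krivineVector p q Φ -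
      ∑ j ∈ range k, (krivineVector p q Φ).mapDomain (fun x : ℝ => (x + (j : ℝ)) / (k : ℝ))) ≤
      (k : ℝ) ^ (1 / p) * (2 * C * (η * #Φ) ^ (1 / p)) := by
  rcases Nat.eq_zero_or_pos k with rfl | hk
  · simp [approxNorms.map_zero hN, hp.ne']
  · have hbound (Ψ : Finset ℕ) (hΨ : ∀ m ∈ Ψ, 0 < m) (hcard : (#Ψ : ℝ) ≤ η * #Φ) :
        N (krivineVector p q Ψ) ≤ C * (η * #Φ) ^ (1 / p) := by
      refine (hC _).2.trans ?_
      rw [powSum_krivineVector hp hq hΨ]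
      exact mul_le_mul_of_nonneg_left
        (Real.rpow_le_rpow (by positivity) hcard (by positivity)) hC0
    rw [sum_mapDomain_krivineVector q hk hΦ, ← smul_sub, approxNorms.smul hN,
      abs_of_nonneg (by positivity), krivineVector_sub, sub_eq_add_neg]
    refine mul_le_mul_of_nonneg_left ((approxNorms.add_le hN _ _).trans ?_) (by positivity)
    rw [approxNorms.neg hN]
    have h1 := hbound (Φ \ Φ.image (k * ·)) (fun m hm => hΦ m (mem_sdiff.1 hm).1) (h hk).1
    have h2 := hbound (Φ.image (k * ·) \ Φ) (fun m hm => by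
      obtain ⟨m', hm', rfl⟩ := mem_image.1 (mem_sdiff.1 hm).1
      exact Nat.mul_pos hk (hΦ m' hm')) (h hk).2
    linarith

lemma sum_shift_rescale_eq (hs : IsSpreading N) (hq0 : 0 < q) (hq1 : q < 1) (Φ : Finset ℕ)
    (n : ℕ → ℕ) (r : ℕ) :
    N (∑ i ∈ range r, (∑ j ∈ range (n i), (krivineVector p q Φ).mapDomain
        (fun x : ℝ => (x + (j : ℝ)) / (n i : ℝ))).mapDomain (fun x : ℝ => x + (i : ℝ))) =
      N (∑ J ∈ range (∑ i ∈ range r, n i), (krivineVector p q Φ).mapDomain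
        (fun x : ℝ => (x + (J : ℝ)) / ((∑ i ∈ range r, n i : ℕ) : ℝ))) := by
  classical
  set z := krivineVector p q Φ with hz
  set k := ∑ i ∈ range r, n i with hk
  let off (i : ℕ) : ℕ := ∑ i' ∈ range i, n i'
  let s : Finset ((_ : ℕ) × ℕ × ℝ) := (range r).sigma fun i => range (n i) ×ˢ z.support
  let e₁ : (_ : ℕ) × ℕ × ℝ → ℝ := fun b => (b.2.2 + b.2.1) / n b.1 + b.1
  let e₂ : (_ : ℕ) × ℕ × ℝ → ℝ := fun b => (b.2.2 + (off b.1 + b.2.1 : ℕ)) / k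
  have h1 : ∑ i ∈ range r, (∑ j ∈ range (n i), z.mapDomain
      (fun x : ℝ => (x + (j : ℝ)) / (n i : ℝ))).mapDomain (fun x : ℝ => x + (i : ℝ)) =
      ∑ b ∈ s, Finsupp.single (e₁ b) (z b.2.2) := by
    rw [sum_sigma]
    refine sum_congr rfl fun i _ => ?_
    rw [sum_product, Finsupp.mapDomain_finsetSum]
    refine sum_congr rfl fun j _ => ?_
    rw [← Finsupp.mapDomain_comp]
    rfl
  have h2 : ∑ J ∈ range k, z.mapDomain (fun x : ℝ => (x + (J : ℝ)) / (k : ℝ)) =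
      ∑ b ∈ s, Finsupp.single (e₂ b) (z b.2.2) := by
    rw [← sum_range_sum_range_offset, sum_sigma]
    refine sum_congr rfl fun i _ => ?_
    rw [sum_product]
    refine sum_congr rfl fun j _ => rfl
  let R : (_ : ℕ) × ℕ × ℝ → (_ : ℕ) × ℕ × ℝ → Prop := fun b b' =>
    b.1 < b'.1 ∨ (b.1 = b'.1 ∧ (b.2.2 : ℝ) + b.2.1 < b'.2.2 + b'.2.1)
  have hmem (b) (hb : b ∈ s) : b.1 < r ∧ b.2.1 < n b.1 ∧ b.2.2 ∈ Set.Ioo (0 : ℝ) 1 := by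
    simp only [s, mem_sigma, mem_range, mem_product] at hb
    exact ⟨hb.1, hb.2.1, krivineVector_support hq0 hq1 Φ hb.2.2⟩
  have hv (b) (hb : b ∈ s) : 0 < b.2.2 + b.2.1 ∧ b.2.2 + b.2.1 < n b.1 := by
    obtain ⟨-, h1, h2, h3⟩ := hmem b hb
    have : (b.2.1 : ℝ) + 1 ≤ n b.1 := by exact_mod_cast h1
    exact ⟨by positivity, by linarith⟩
  have hR1 (b) (hb : b ∈ s) (b') (hb' : b' ∈ s) (h : R b b') : e₁ b < e₁ b' := by
    obtain ⟨u1, u2⟩ := hv b hb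
    obtain ⟨u1', u2'⟩ := hv b' hb'
    rcases h with h | ⟨h, h'⟩
    · have : (b.1 : ℝ) + 1 ≤ b'.1 := by exact_mod_cast h
      have h3 : (b.2.2 + b.2.1) / n b.1 < 1 := by rw [div_lt_one (u1.trans u2)]; exact u2
      have h4 : 0 < (b'.2.2 + b'.2.1) / n b'.1 := div_pos u1' (u1'.trans u2')
      simp only [e₁]; linarith
    · simp only [e₁, ← h]
      have := div_lt_div_of_pos_right h' (u1.trans u2)
      linarith
  have hR2 (b) (hb : b ∈ s) (b') (hb' : b' ∈ s) (h : R b b') : e₂ b < e₂ b' := by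
    obtain ⟨u1, u2⟩ := hv b hb
    obtain ⟨u1', u2'⟩ := hv b' hb'
    have hk0 : (0 : ℝ) < k := by
      have : n b.1 ≤ k := single_le_sum (f := n) (fun _ _ => Nat.zero_le _)
        (mem_range.2 (hmem b hb).1)
      have h3 : (n b.1 : ℝ) ≤ k := by exact_mod_cast this
      linarith
    refine div_lt_div_of_pos_right ?_ hk0
    push_cast
    rcases h with h | ⟨h, h'⟩
    · have : off b.1 + n b.1 ≤ off b'.1 := by
        simp only [off]
        rw [← sum_range_succ]
        exact sum_le_sum_of_subset (range_mono h)
      have h3 : (off b.1 : ℝ) + n b.1 ≤ off b'.1 := by exact_mod_cast this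
      linarith
    · rw [← h]; linarith
  have htri (b) (hb : b ∈ s) (b') (hb' : b' ∈ s) : R b b' ∨ b = b' ∨ R b' b := by
    obtain ⟨i, j, x⟩ := b
    obtain ⟨i', j', x'⟩ := b'
    obtain ⟨-, -, h1, h2⟩ := hmem _ hb
    obtain ⟨-, -, h1', h2'⟩ := hmem _ hb'
    simp only at h1 h2 h1' h2'
    rcases lt_trichotomy i i' with h | rfl | h
    · exact .inl (.inl h)
    · rcases lt_trichotomy (x + j) (x' + j') with h | h | h
      · exact .inl (.inr ⟨rfl, h⟩)
      · refine .inr (.inl ?_)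
        have hj : j = j' := by
          have h3 : (j : ℝ) < j' + 1 := by linarith
          have h4 : (j' : ℝ) < j + 1 := by linarith
          have h3' : j < j' + 1 := by exact_mod_cast h3
          have h4' : j' < j + 1 := by exact_mod_cast h4
          omega
        subst hj
        simpa using h
      · exact .inr (.inr (.inr ⟨rfl, h⟩))
    · exact .inr (.inr (.inl h))
  rw [h1, h2]
  refine hs s _ e₁ e₂ ?_ ?_
  · intro b hb b' hb' h
    rcases htri b hb b' hb' with h' | h' | h'
    · exact absurd h (hR1 b hb b' hb' h').ne
    · exact h'
    · exact absurd h (hR1 b' hb' b hb h').ne'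
  · intro b hb b' hb'
    rcases htri b hb b' hb' with h' | rfl | h'
    · exact iff_of_true (hR1 b hb b' hb' h') (hR2 b hb b' hb' h')
    · simp
    · exact iff_of_false (hR1 b' hb' b hb h').not_gt (hR2 b' hb' b hb h').not_gt

end KrivineVector

section Krivine

variable {Z : Type*} [NormedAddCommGroup Z] [NormedSpace ℝ Z] {N : (ℝ →₀ ℝ) → ℝ} {p C q : ℝ}

/-- The linear map sending the `i`-th unit vector to the translate of `z` by `i`. -/
def translates (z : ℝ →₀ ℝ) : (ℕ →₀ ℝ) →ₗ[ℝ] (ℝ →₀ ℝ) :=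
  Finsupp.linearCombination ℝ fun i : ℕ => z.mapDomain fun x : ℝ => x + (i : ℝ)

lemma translates_sum_single (z : ℝ →₀ ℝ) (s : Finset ℕ) (c : ℕ → ℝ) :
    translates z (∑ i ∈ s, Finsupp.single i (c i)) =
      ∑ i ∈ s, c i • z.mapDomain fun x : ℝ => x + (i : ℝ) := by
  simp [translates]

lemma strictMono_add_natCast (i : ℕ) : StrictMono fun x : ℝ => x + (i : ℝ) :=
  fun _ _ h => by simpa using h

lemma abs_translates_sub_le (hN : N ∈ approxNorms Z (ℝ →₀ ℝ)) (hs : IsSpreading N) (hp : 0 < p)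
    (hC : IsLpEquiv p C N) (hC0 : 0 ≤ C) (hq : Irrational q) (hq0 : 0 < q) (hq1 : q < 1)
    {Φ : Finset ℕ} (hΦ : ∀ m ∈ Φ, 0 < m) {K : ℕ} {η : ℝ}
    (h : ∀ k, 0 < k → k ≤ K →
      (#(Φ \ Φ.image (k * ·)) : ℝ) ≤ η * #Φ ∧ (#(Φ.image (k * ·) \ Φ) : ℝ) ≤ η * #Φ)
    (n : ℕ → ℕ) (r : ℕ) (hn : ∑ i ∈ range r, n i ≤ K) :
    |N (translates (krivineVector p q Φ) (∑ i ∈ range r, Finsupp.single i ((n i : ℝ) ^ (1 / p)))) -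
      ((∑ i ∈ range r, n i : ℕ) : ℝ) ^ (1 / p) * N (krivineVector p q Φ)| ≤
      (∑ i ∈ range r, (n i : ℝ) ^ (1 / p) + ((∑ i ∈ range r, n i : ℕ) : ℝ) ^ (1 / p)) *
        (2 * C * (η * #Φ) ^ (1 / p)) := by
  set z := krivineVector p q Φ with hz
  set k := ∑ i ∈ range r, n i with hk
  set B := 2 * C * (η * #Φ) ^ (1 / p) with hB
  let S (m : ℕ) : ℝ →₀ ℝ := ∑ j ∈ range m, z.mapDomain fun x : ℝ => (x + (j : ℝ)) / (m : ℝ)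
  have hS (m : ℕ) (hm : m ≤ K) : N ((m : ℝ) ^ (1 / p) • z - S m) ≤ (m : ℝ) ^ (1 / p) * B :=
    smul_sub_sum_mapDomain_le hN hp hC hC0 hq hΦ fun h0 => h m h0 hm
  have h1 : N (∑ i ∈ range r, (S (n i)).mapDomain fun x : ℝ => x + (i : ℝ)) = N (S k) :=
    sum_shift_rescale_eq hs hq0 hq1 Φ n r
  have h2 : N (translates z (∑ i ∈ range r, Finsupp.single i ((n i : ℝ) ^ (1 / p))) -
      ∑ i ∈ range r, (S (n i)).mapDomain fun x : ℝ => x + (i : ℝ)) ≤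
      ∑ i ∈ range r, (n i : ℝ) ^ (1 / p) * B := by
    rw [translates_sum_single, ← sum_sub_distrib]
    refine (approxNorms.sum_le hN _ _).trans (sum_le_sum fun i hi => ?_)
    have h3 : (n i : ℝ) ^ (1 / p) • z.mapDomain (fun x : ℝ => x + (i : ℝ)) -
        (S (n i)).mapDomain (fun x : ℝ => x + (i : ℝ)) =
        ((n i : ℝ) ^ (1 / p) • z - S (n i)).mapDomain (fun x : ℝ => x + (i : ℝ)) := by
      have := map_sub (Finsupp.lmapDomain ℝ ℝ (fun x : ℝ => x + (i : ℝ)))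
        ((n i : ℝ) ^ (1 / p) • z) (S (n i))
      simpa [Finsupp.lmapDomain_apply, Finsupp.mapDomain_smul] using this.symm
    rw [h3, hs.mapDomain (strictMono_add_natCast i)]
    exact hS _ ((single_le_sum (f := n) (fun _ _ => Nat.zero_le _) hi).trans hn)
  have h4 := (approxNorms.abs_sub_le hN _ _).trans h2
  have h5 := (approxNorms.abs_sub_le hN _ _).trans (hS k hn)
  rw [approxNorms.smul hN, abs_of_nonneg (by positivity : (0 : ℝ) ≤ (k : ℝ) ^ (1 / p))] at h5
  rw [h1, ← sum_mul] at h4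
  rw [abs_le] at h4 h5 ⊢
  constructor <;> linarith [h4.1, h4.2, h5.1, h5.2]

lemma translates_le (hN : N ∈ approxNorms Z (ℝ →₀ ℝ)) (hs : IsSpreading N) (z : ℝ →₀ ℝ)
    (f : ℕ →₀ ℝ) : N (translates z f) ≤ (∑ i ∈ f.support, |f i|) * N z := by
  rw [translates, Finsupp.linearCombination_apply, Finsupp.sum, sum_mul]
  refine (approxNorms.sum_le hN _ _).trans (sum_le_sum fun i _ => ?_)
  rw [approxNorms.smul hN, hs.mapDomain (strictMono_add_natCast i)]

lemma translates_sum_single_abs (hsign : IsSignInvariant N) {z : ℝ →₀ ℝ}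
    (hz : ∀ x ∈ z.support, x ∈ Set.Ioo (0 : ℝ) 1) (s : Finset ℕ) (c : ℕ → ℝ) :
    N (translates z (∑ i ∈ s, Finsupp.single i (c i))) =
      N (translates z (∑ i ∈ s, Finsupp.single i |c i|)) := by
  have h (c : ℕ → ℝ) : translates z (∑ i ∈ s, Finsupp.single i (c i)) =
      ∑ b ∈ s ×ˢ z.support, Finsupp.single (b.2 + (b.1 : ℝ)) (c b.1 * z b.2) := by
    rw [translates_sum_single, sum_product]
    refine sum_congr rfl fun i _ => ?_
    simp [Finsupp.mapDomain, Finsupp.sum, smul_sum]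
  rw [h, h]
  refine hsign _ _ _ _ ?_ fun b _ => by simp [abs_mul]
  rintro ⟨i, x⟩ hb ⟨i', x'⟩ hb' he
  simp only [coe_product, Set.mem_prod, mem_coe] at hb hb' he
  obtain ⟨h1, h2⟩ := hz _ hb.2
  obtain ⟨h1', h2'⟩ := hz _ hb'.2
  have hi : i = i' := by
    have h3 : (i : ℝ) < i' + 1 := by linarith
    have h4 : (i' : ℝ) < i + 1 := by linarith
    have h3' : i < i' + 1 := by exact_mod_cast h3
    have h4' : i' < i + 1 := by exact_mod_cast h4
    omega
  subst hi
  simpa using he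

lemma eq_powSum_rpow {M : (ℕ →₀ ℝ) → ℝ} (hM : M ∈ approxNorms Z (ℕ →₀ ℝ)) (hp : 0 < p)
    (hle : ∀ f, M f ≤ ∑ i ∈ f.support, |f i|)
    (habs : ∀ (c : ℕ → ℝ) (r : ℕ), M (∑ i ∈ range r, Finsupp.single i (c i)) =
      M (∑ i ∈ range r, Finsupp.single i |c i|))
    (hnat : ∀ (n : ℕ → ℕ) (r : ℕ), M (∑ i ∈ range r, Finsupp.single i ((n i : ℝ) ^ (1 / p))) =
      ((∑ i ∈ range r, n i : ℕ) : ℝ) ^ (1 / p)) (f : ℕ →₀ ℝ) :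
    M f = powSum p f ^ (1 / p) := by
  obtain ⟨r, hr⟩ : ∃ r, f.support ⊆ range r := by
    refine ⟨f.support.sup id + 1, fun i hi => mem_range.2 (Nat.lt_succ_of_le ?_)⟩
    exact le_sup (f := id) hi
  have hf : f = ∑ i ∈ range r, Finsupp.single i (f i) := by
    conv_lhs => rw [← f.sum_single]
    exact Finsupp.sum_of_support_subset _ hr _ (by simp)
  let m (d i : ℕ) : ℕ := ⌊|f i| ^ p * d⌋₊
  have hlim (i : ℕ) : Tendsto (fun d : ℕ => (m d i : ℝ) / d) atTop (𝓝 (|f i| ^ p)) :=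
    (tendsto_nat_floor_mul_div_atTop (R := ℝ) (by positivity)).comp tendsto_natCast_atTop_atTop
  have hlim' (i : ℕ) : Tendsto (fun d : ℕ => ((m d i : ℝ) / d) ^ (1 / p)) atTop (𝓝 |f i|) := by
    have := (hlim i).rpow_const (p := 1 / p) (Or.inr (by positivity))
    rwa [one_div, Real.rpow_rpow_inv (abs_nonneg _) hp.ne', ← one_div] at this
  have hval (d : ℕ) : M (∑ i ∈ range r, Finsupp.single i (((m d i : ℝ) / d) ^ (1 / p))) =
      (∑ i ∈ range r, (m d i : ℝ) / d) ^ (1 / p) := by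
    have h1 : ∑ i ∈ range r, Finsupp.single i (((m d i : ℝ) / d) ^ (1 / p)) =
        ((d : ℝ) ^ (1 / p))⁻¹ • ∑ i ∈ range r, Finsupp.single i ((m d i : ℝ) ^ (1 / p)) := by
      rw [smul_sum]
      refine sum_congr rfl fun i _ => ?_
      rw [Finsupp.smul_single, Real.div_rpow (by positivity) (by positivity), smul_eq_mul,
        div_eq_inv_mul]
    rw [h1, approxNorms.smul hM, hnat, abs_of_nonneg (by positivity), ← sum_div,
      Real.div_rpow (by positivity) (by positivity), inv_mul_eq_div]
    push_cast
    rfl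
  have hA : Tendsto (fun d : ℕ => (∑ i ∈ range r, (m d i : ℝ) / d) ^ (1 / p)) atTop
      (𝓝 (powSum p f ^ (1 / p))) := by
    rw [powSum_eq_sum hp f hr]
    exact (tendsto_finsetSum _ fun i _ => hlim i).rpow_const (Or.inr (by positivity))
  have hsingle (i : ℕ) (c : ℝ) : M (Finsupp.single i c) ≤ |c| := by
    refine (hle _).trans ?_
    refine (sum_le_sum_of_subset_of_nonneg Finsupp.support_single_subset
      fun _ _ _ => abs_nonneg _).trans ?_
    simp
  have hB : Tendsto (fun d : ℕ => M (∑ i ∈ range r,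
      Finsupp.single i (((m d i : ℝ) / d) ^ (1 / p)))) atTop
      (𝓝 (M (∑ i ∈ range r, Finsupp.single i |f i|))) := by
    rw [tendsto_iff_norm_sub_tendsto_zero]
    have h0 : Tendsto (fun d : ℕ => ∑ i ∈ range r, |((m d i : ℝ) / d) ^ (1 / p) - (|f i|)|) atTop
        (𝓝 0) := by
      have := tendsto_finsetSum (range r) fun i _ => ((hlim' i).sub_const (|f i|)).abs
      simpa using this
    refine squeeze_zero (fun _ => norm_nonneg _) (fun d => ?_) h0
    rw [Real.norm_eq_abs]
    refine (approxNorms.abs_sub_le hM _ _).trans ?_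
    rw [← sum_sub_distrib]
    refine (approxNorms.sum_le hM _ _).trans (sum_le_sum fun i _ => ?_)
    rw [← Finsupp.single_sub]
    exact hsingle _ _
  simp only [hval] at hB
  rw [← tendsto_nhds_unique hB hA, ← habs, ← hf]

/-- A form of Krivine's theorem for norms that are already equivalent to an `ℓ_p` norm. -/
theorem powSum_rpow_mem_approxNorms (hN : N ∈ approxNorms Z (ℝ →₀ ℝ)) (hp : 0 < p)
    (hC : IsLpEquiv p C N) (hs : IsSpreading N) (hsign : IsSignInvariant N) :
    (fun f : ℕ →₀ ℝ => powSum p f ^ (1 / p)) ∈ approxNorms Z (ℕ →₀ ℝ) := by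
  have hC0 : 0 ≤ C := by
    have h := hC (Finsupp.single 0 1)
    rw [powSum_single hp] at h
    simp only [abs_one, Real.one_rpow, mul_one] at h
    linarith [h.1, h.2]
  obtain ⟨q, hq, hq0, hq1⟩ : ∃ q : ℝ, Irrational q ∧ 0 < q ∧ q < 1 := by
    obtain ⟨q, hq, h0, h1⟩ := exists_irrational_btwn (zero_lt_one (α := ℝ))
    exact ⟨q, hq, h0, h1⟩
  choose Φ hne hpos hΦ using fun l : ℕ =>
    exists_folner l (show (0 : ℝ) < 1 / ((l : ℝ) + 1) by positivity)
  let z (l : ℕ) := krivineVector p q (Φ l)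
  have hz (l : ℕ) : (#(Φ l) : ℝ) ^ (1 / p) ≤ N (z l) := by
    have := (hC (z l)).1
    rwa [powSum_krivineVector hp hq (hpos l)] at this
  have hz0 (l : ℕ) : 0 < N (z l) :=
    (Real.rpow_pos_of_pos (by exact_mod_cast (hne l).card_pos) _).trans_le (hz l)
  let M (l : ℕ) (f : ℕ →₀ ℝ) : ℝ := (N (z l))⁻¹ * N (translates (z l) f)
  have hM (l : ℕ) : M l ∈ approxNorms Z (ℕ →₀ ℝ) :=
    approxNorms.const_mul (approxNorms.comp hN _) (inv_nonneg.2 (hz0 l).le)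
  have hb (f : ℕ →₀ ℝ) : ∀ᶠ l in (hyperfilter ℕ : Filter ℕ),
      M l f ∈ Set.Icc 0 (∑ i ∈ f.support, |f i|) := by
    refine Eventually.of_forall fun l => ⟨approxNorms.nonneg (hM l) f, ?_⟩
    rw [inv_mul_le_iff₀ (hz0 l), mul_comm]
    exact translates_le hN hs _ _
  choose N' hN' hlim using fun f => Ultrafilter.exists_tendsto_of_eventually_mem_Icc _ (hb f)
  have hmem : N' ∈ approxNorms Z (ℕ →₀ ℝ) :=
    approxNorms.of_tendsto (Eventually.of_forall hM) (tendsto_pi_nhds.2 hlim)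
  have hfin : N' = fun f : ℕ →₀ ℝ => powSum p f ^ (1 / p) := by
    funext f
    refine eq_powSum_rpow hmem hp (fun f => (hN' f).2) (fun c r => ?_) (fun n r => ?_) f
    · refine tendsto_nhds_unique (hlim _) ((hlim _).congr fun l => ?_)
      simp only [M]
      rw [translates_sum_single_abs hsign (c := c) fun x => krivineVector_support hq0 hq1 (Φ l)]
    · set k := ∑ i ∈ range r, n i with hk
      refine tendsto_nhds_unique (hlim _) ?_
      rw [tendsto_iff_norm_sub_tendsto_zero]
      set D := ∑ i ∈ range r, (n i : ℝ) ^ (1 / p) + (k : ℝ) ^ (1 / p) with hD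
      have h0 : Tendsto (fun l : ℕ => D * (2 * C * (1 / ((l : ℝ) + 1)) ^ (1 / p)))
          (hyperfilter ℕ : Filter ℕ) (𝓝 0) := by
        have h1 := (tendsto_one_div_add_atTop_nhds_zero_nat (𝕜 := ℝ)).rpow_const (p := 1 / p)
          (Or.inr (by positivity))
        rw [Real.zero_rpow (by positivity)] at h1
        simpa using ((h1.const_mul (2 * C)).const_mul D).mono_left Nat.hyperfilter_le_atTop
      refine squeeze_zero' (Eventually.of_forall fun _ => norm_nonneg _) ?_ h0
      filter_upwards [Nat.hyperfilter_le_atTop (eventually_ge_atTop k)] with l hl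
      have h2 := abs_translates_sub_le hN hs hp hC hC0 hq hq0 hq1 (hpos l) (hΦ l) n r hl
      have h3 : M l (∑ i ∈ range r, Finsupp.single i ((n i : ℝ) ^ (1 / p))) - (k : ℝ) ^ (1 / p) =
          (N (z l))⁻¹ * (N (translates (z l) (∑ i ∈ range r,
            Finsupp.single i ((n i : ℝ) ^ (1 / p)))) - (k : ℝ) ^ (1 / p) * N (z l)) := by
        have := (hz0 l).ne'
        simp only [M]
        field_simp
      rw [h3, Real.norm_eq_abs, abs_mul, abs_of_pos (inv_pos.2 (hz0 l)), inv_mul_le_iff₀ (hz0 l)]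
      refine h2.trans ?_
      rw [Real.mul_rpow (by positivity) (by positivity)]
      have hD0 : 0 ≤ D := by positivity
      have h4 : D * (2 * C * ((1 / ((l : ℝ) + 1)) ^ (1 / p) * (#(Φ l) : ℝ) ^ (1 / p))) ≤
          D * (2 * C * ((1 / ((l : ℝ) + 1)) ^ (1 / p) * N (z l))) := by
        have := hz l
        gcongr
      refine h4.trans (le_of_eq ?_)
      ring
  rw [← hfin]
  exact hmem

end Krivine

section LpNorm

/-- The truncation of a sequence in `ℓ_p` to its first `m` coordinates. -/
def truncation (P : ℝ≥0∞) (m : ℕ) : lp (fun _ : ℕ => ℝ) P →ₗ[ℝ] (ℕ →₀ ℝ) where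
  toFun x := ∑ i ∈ range m, Finsupp.single i (x i)
  map_add' x y := by simp [sum_add_distrib]
  map_smul' c x := by simp [smul_sum]

theorem norm_mem_approxNorms_lp {Z : Type*} [NormedAddCommGroup Z] [NormedSpace ℝ Z] {p : ℝ}
    (hp : 1 < p) [Fact (1 ≤ ENNReal.ofReal p)] (hZ : UnifContainsLp (ENNReal.ofReal p) Z) :
    (fun x : lp (fun _ : ℕ => ℝ) (ENNReal.ofReal p) => ‖x‖) ∈
      approxNorms Z (lp (fun _ : ℕ => ℝ) (ENNReal.ofReal p)) := by
  have hp0 : 0 < p := by linarith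
  have hP : (ENNReal.ofReal p).toReal = p := ENNReal.toReal_ofReal hp0.le
  obtain ⟨C, N₀, hN₀, hC₀⟩ := exists_isLpEquiv_of_unifContainsLp hp hZ
  obtain ⟨N₁, hN₁, hC₁, hs₁⟩ := exists_isSpreading hp0 hC₀ hN₀ (ℝ ×ₗ ℕ)
  obtain ⟨N, hN, hC, hs, hsign⟩ := exists_isSignInvariant hp0 hN₁ hC₁ hs₁
  have hM := powSum_rpow_mem_approxNorms hN hp0 hC hs hsign
  refine approxNorms.of_tendsto (l := atTop) (Eventually.of_forall fun m : ℕ =>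
    approxNorms.comp hM (truncation (ENNReal.ofReal p) m)) (tendsto_pi_nhds.2 fun x => ?_)
  have h1 : HasSum (fun i => |x i| ^ p) (‖x‖ ^ p) := by
    have := lp.hasSum_norm (by rw [hP]; exact hp0) x
    simpa [hP] using this
  have h2 := h1.tendsto_sum_nat.rpow_const (p := 1 / p) (Or.inr (by positivity))
  rw [one_div, Real.rpow_rpow_inv (norm_nonneg _) hp0.ne', ← one_div] at h2
  refine h2.congr fun m => ?_
  rw [truncation, LinearMap.coe_mk, AddHom.coe_mk,
    powSum_sum_single hp0 (range m) (fun i => i) (fun i => x i) (Set.injOn_id _)]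

lemma exists_linearMap_abs_norm_sub_le {Z V : Type*} [NormedAddCommGroup Z] [NormedSpace ℝ Z]
    [NormedAddCommGroup V] [NormedSpace ℝ V] [FiniteDimensional ℝ V]
    (h : (fun v : V => ‖v‖) ∈ approxNorms Z V) {ε : ℝ} (hε : 0 < ε) :
    ∃ T : V →ₗ[ℝ] Z, ∀ v, |‖T v‖ - ‖v‖| ≤ ε * ‖v‖ := by
  let b := Module.finBasis ℝ V
  let e : V →L[ℝ] (Fin (Module.finrank ℝ V) → ℝ) := (b.equivFunL : V →L[ℝ] _)
  set M : ℝ := ∑ i, ‖e‖ * (‖b i‖ + 1) with hM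
  have hM0 : 0 ≤ M := by positivity
  set δ := ε / (2 * (M + 1)) with hδ
  have hδ0 : 0 < δ := by positivity
  obtain ⟨S, hS, hSfin, hcov⟩ := (isCompact_sphere (0 : V) 1).finite_cover_balls hδ0
  have hev : ∀ᶠ N : V → ℝ in 𝓝 (fun v : V => ‖v‖),
      (∀ s ∈ S, |N s - ‖s‖| < ε / 2) ∧ ∀ i, |N (b i) - ‖b i‖| < 1 := by
    have h1 (v : V) {r : ℝ} (hr : 0 < r) :
        ∀ᶠ N : V → ℝ in 𝓝 (fun v : V => ‖v‖), |N v - ‖v‖| < r := by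
      have : Tendsto (fun N : V → ℝ => |N v - ‖v‖|) (𝓝 fun v : V => ‖v‖) (𝓝 |‖v‖ - ‖v‖|) :=
        (Continuous.tendsto (by fun_prop) _)
      rw [sub_self, abs_zero] at this
      exact this.eventually_lt_const hr
    exact ((Set.Finite.eventually_all hSfin).2 fun s _ => h1 s (half_pos hε)).and
      (eventually_all.2 fun i => h1 _ one_pos)
  obtain ⟨N, ⟨hNS, hNb⟩, T, rfl⟩ := ((mem_closure_iff_frequently.1 h).and_eventually hev).exists.imp
    fun N h => And.symm h
  have hT (v : V) : ‖T v‖ ≤ M * ‖v‖ := by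
    conv_lhs => rw [← b.sum_equivFun v, map_sum]
    refine (norm_sum_le _ _).trans ?_
    rw [hM, sum_mul]
    refine sum_le_sum fun i _ => ?_
    rw [map_smul, norm_smul]
    have h1 : ‖b.equivFun v i‖ ≤ ‖e‖ * ‖v‖ :=
      (norm_le_pi_norm (b.equivFun v) i).trans (e.le_opNorm v)
    have h2 : ‖T (b i)‖ ≤ ‖b i‖ + 1 := by linarith [(abs_lt.1 (hNb i)).2]
    calc _ ≤ (‖e‖ * ‖v‖) * (‖b i‖ + 1) := by gcongr
      _ = _ := by ring
  refine ⟨T, fun v => ?_⟩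
  rcases eq_or_ne v 0 with rfl | hv
  · simp
  have hv' : 0 < ‖v‖ := norm_pos_iff.2 hv
  have hu (u : V) (hu : ‖u‖ = 1) : |‖T u‖ - ‖u‖| ≤ ε := by
    obtain ⟨s, hs, hsu⟩ := Set.mem_iUnion₂.1
      (hcov (show u ∈ Metric.sphere (0 : V) 1 by simpa using hu))
    rw [Metric.mem_ball, dist_eq_norm] at hsu
    have h1 : |‖T u‖ - ‖T s‖| ≤ M * δ := by
      refine (abs_norm_sub_norm_le _ _).trans ?_
      rw [← map_sub]
      exact (hT _).trans (by gcongr)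
    have h2 : |‖u‖ - ‖s‖| ≤ δ := (abs_norm_sub_norm_le _ _).trans hsu.le
    have h3 := hNS s hs
    have h4 : (M + 1) * δ = ε / 2 := by rw [hδ]; field_simp
    rw [abs_le] at h1 h2 ⊢
    rw [abs_lt] at h3
    constructor <;> linarith [h1.1, h1.2, h2.1, h2.2, h3.1, h3.2]
  have := hu (‖v‖⁻¹ • v) (by rw [norm_smul, norm_inv, norm_norm, inv_mul_cancel₀ hv'.ne'])
  rw [map_smul, norm_smul, norm_smul, ← mul_sub, abs_mul, norm_inv, norm_norm,
    abs_of_nonneg (by positivity : 0 ≤ ‖v‖⁻¹), inv_mul_le_iff₀ hv'] at this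
  linarith

end LpNorm

section Perturbation

open scoped NNReal

variable {E : Type*} [NormedAddCommGroup E] [NormedSpace ℝ E]

lemma ConvexOn.abs_sub_sub_le_of_close {g h : E → ℝ} (hg : ConvexOn ℝ Set.univ g) {h' : E →L[ℝ] ℝ}
    {r η : ℝ} (hr : 0 < r)
    (hh : ∀ x ∈ Metric.closedBall (0 : E) (2 * r), ∀ y ∈ Metric.closedBall (0 : E) (2 * r),
      |h x - h y - h' (x - y)| ≤ η * ‖x - y‖)
    (hgh : ∀ x ∈ Metric.closedBall (0 : E) (2 * r), |g x - h x| ≤ η * r) {x y : E}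
    (hx : x ∈ Metric.closedBall (0 : E) r) (hy : y ∈ Metric.closedBall (0 : E) r) :
    |g x - g y - h' (x - y)| ≤ 3 * η * ‖x - y‖ := by
  have key (x y : E) (hx : x ∈ Metric.closedBall (0 : E) r) (hy : y ∈ Metric.closedBall (0 : E) r) :
      g y - g x - h' (y - x) ≤ 3 * η * ‖y - x‖ := by
    rcases eq_or_ne y x with rfl | hne
    · simp
    set d := ‖y - x‖ with hd
    have hd0 : 0 < d := norm_pos_iff.2 (sub_ne_zero.2 hne)
    set w := y + (r / d) • (y - x) with hw
    have hy0 : ‖y‖ ≤ r := by simpa using hy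
    have hwy : w - y = (r / d) • (y - x) := by simp [hw]
    have hwn : ‖w - y‖ = r := by
      rw [hwy, norm_smul, Real.norm_of_nonneg (by positivity), ← hd, div_mul_cancel₀ _ hd0.ne']
    have hy2 : y ∈ Metric.closedBall (0 : E) (2 * r) := by simp; linarith
    have hw2 : w ∈ Metric.closedBall (0 : E) (2 * r) := by
      have := norm_add_le (w - y) y
      simp only [sub_add_cancel, hwn] at this
      simp; linarith
    have h1 : y = (r / (r + d)) • x + (d / (r + d)) • w := by
      have h2 : r + d ≠ 0 := by positivity
      rw [hw]
      match_scalars <;> field_simp <;> ring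
    have h2 := hg.2 (Set.mem_univ x) (Set.mem_univ w) (show 0 ≤ r / (r + d) by positivity)
      (show 0 ≤ d / (r + d) by positivity) (by field_simp)
    rw [← h1, smul_eq_mul, smul_eq_mul, div_mul_eq_mul_div, div_mul_eq_mul_div, ← add_div,
      le_div_iff₀ (by positivity)] at h2
    have h3 := (abs_le.1 (hh w hw2 y hy2)).2
    rw [hwn, hwy, map_smul, smul_eq_mul] at h3
    have h4 := (abs_le.1 (hgh w hw2)).2
    have h5 := (abs_le.1 (hgh y hy2)).1
    have h6 : r * (g y - g x) ≤ d * (r / d * h' (y - x) + 3 * η * r) := by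
      have : d * (g w - g y) ≤ d * (r / d * h' (y - x) + 3 * η * r) := by gcongr; linarith
      linarith
    have h7 : d * (r / d * h' (y - x) + 3 * η * r) = r * (h' (y - x) + 3 * η * d) := by
      field_simp
    rw [h7] at h6
    have := le_of_mul_le_mul_left h6 hr
    linarith
  have h1 := key x y hx hy
  have h2 := key y x hy hx
  rw [norm_sub_rev, ← neg_sub x y, map_neg] at h1
  rw [abs_le]
  constructor <;> linarith

lemma HasStrictFDerivAt.exists_eq_of_convex_close [CompleteSpace E] {Q : Type*} [Fintype Q]
    {h : E → Q → ℝ} {A : E →L[ℝ] (Q → ℝ)} (hA : HasStrictFDerivAt h A 0)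
    (hsurj : Function.Surjective A) :
    ∃ r > 0, ∃ δ > 0, ∀ g : E → Q → ℝ, (∀ q, ConvexOn ℝ Set.univ fun y => g y q) →
      (∀ y, ‖y‖ ≤ r → ∀ q, |g y q - h y q| ≤ δ) → ∃ y, g y = h 0 := by
  let S := A.nonlinearRightInverseOfSurjective (LinearMap.range_eq_top.2 hsurj)
  have hS : 0 < S.nnnorm := A.nonlinearRightInverseOfSurjective_nnnorm_pos _
  set η : ℝ≥0 := S.nnnorm⁻¹ / 6 with hη
  have hη0 : 0 < η := by positivity
  obtain ⟨s, hs, hs'⟩ := hA.approximates_deriv_on_nhds (c := η) (Or.inr hη0)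
  obtain ⟨r', hr', hball⟩ := Metric.nhds_basis_closedBall.mem_iff.1 hs
  set r := r' / 2 with hr
  have hr0 : 0 < r := half_pos hr'
  have hrr : 2 * r = r' := by rw [hr]; ring
  refine ⟨r', hr', η * r, by positivity, fun g hg hgh => ?_⟩
  have happ : ApproximatesLinearOn g A (Metric.closedBall 0 r) (3 * η) := by
    intro x hx y hy
    rw [pi_norm_le_iff_of_nonneg (by positivity)]
    intro q
    have := (hg q).abs_sub_sub_le_of_close (h := fun y => h y q)
      (h' := (ContinuousLinearMap.proj q).comp A) (η := η) hr0 (fun x hx y hy => ?_)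
      (fun x hx => hgh x (by simpa [hrr] using hx) q) hx hy
    · simpa using this
    · have := hs' x (hball (by rwa [← hrr])) y (hball (by rwa [← hrr]))
      exact (norm_le_pi_norm (h x - h y - A (x - y)) q).trans this
  obtain ⟨y, -, hy⟩ := happ.surjOn_closedBall_of_nonlinearRightInverse S hr0.le le_rfl
    (show h 0 ∈ Metric.closedBall (g 0) (((S.nnnorm : ℝ)⁻¹ - (3 * η : ℝ≥0)) * r) by
      have h1 : ((S.nnnorm : ℝ)⁻¹ - (3 * η : ℝ≥0)) = 3 * η := by
        push_cast [hη]; ring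
      rw [h1, Metric.mem_closedBall, dist_comm, dist_pi_le_iff (by positivity)]
      intro q
      rw [Real.dist_eq]
      refine (hgh 0 (by simpa using hr'.le) q).trans ?_
      have : 0 ≤ (η : ℝ) * r := by positivity
      linarith)
  exact ⟨y, hy⟩

lemma convexOn_norm_add_rpow {F : Type*} [NormedAddCommGroup F] [NormedSpace ℝ F] {p : ℝ}
    (hp : 1 ≤ p) (a : F) (S : E →ₗ[ℝ] F) : ConvexOn ℝ Set.univ fun y => ‖a + S y‖ ^ p := by
  refine ⟨convex_univ, fun x _ y _ s t hs ht hst => ?_⟩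
  have h1 : a + S (s • x + t • y) = s • (a + S x) + t • (a + S y) := by
    rw [map_add, map_smul, map_smul, smul_add, smul_add, add_add_add_comm, ← add_smul, hst,
      one_smul]
  have h2 : ‖a + S (s • x + t • y)‖ ≤ s * ‖a + S x‖ + t * ‖a + S y‖ := by
    rw [h1]
    refine (norm_add_le _ _).trans ?_
    rw [norm_smul, norm_smul, Real.norm_of_nonneg hs, Real.norm_of_nonneg ht]
  exact (Real.rpow_le_rpow (norm_nonneg _) h2 (by linarith)).trans
    ((convexOn_rpow hp).2 (norm_nonneg (a + S x)) (norm_nonneg (a + S y)) hs ht hst)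

lemma exists_abs_rpow_sub_rpow_le {p R δ : ℝ} (hp : 0 < p) (hδ : 0 < δ) :
    ∃ ε > 0, ∀ a b : ℝ, 0 ≤ a → a ≤ R → 0 ≤ b → |b - a| ≤ ε * a → |b ^ p - a ^ p| ≤ δ := by
  have h1 : Tendsto (fun ε : ℝ => (1 + ε) ^ p * R ^ p - R ^ p) (𝓝 0) (𝓝 0) := by
    have : ContinuousAt (fun ε : ℝ => (1 + ε) ^ p * R ^ p - R ^ p) 0 := by
      have : ContinuousAt (fun ε : ℝ => (1 + ε) ^ p) 0 :=
        (continuousAt_const.add continuousAt_id).rpow_const (Or.inr hp.le)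
      fun_prop
    simpa [ContinuousAt] using this
  have h2 : Tendsto (fun ε : ℝ => R ^ p - (1 - ε) ^ p * R ^ p) (𝓝 0) (𝓝 0) := by
    have : ContinuousAt (fun ε : ℝ => R ^ p - (1 - ε) ^ p * R ^ p) 0 := by
      have : ContinuousAt (fun ε : ℝ => (1 - ε) ^ p) 0 :=
        (continuousAt_const.sub continuousAt_id).rpow_const (Or.inr hp.le)
      fun_prop
    simpa [ContinuousAt] using this
  obtain ⟨ε, ⟨⟨hε1, hε2⟩, hε3⟩, hε0⟩ := ((((h1.eventually_lt_const hδ).and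
    (h2.eventually_lt_const hδ)).and (eventually_lt_nhds (zero_lt_one (α := ℝ)))).filter_mono
      nhdsWithin_le_nhds |>.and (self_mem_nhdsWithin (s := Set.Ioi (0 : ℝ)))).exists
  replace hε0 : 0 < ε := hε0
  refine ⟨ε, hε0, fun a b ha haR hb hab => ?_⟩
  rw [abs_le] at hab
  have h3 : b ^ p ≤ (1 + ε) ^ p * a ^ p := by
    rw [← Real.mul_rpow (by linarith) ha]
    exact Real.rpow_le_rpow hb (by linarith) hp.le
  have h4 : (1 - ε) ^ p * a ^ p ≤ b ^ p := by
    rw [← Real.mul_rpow (by linarith) ha]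
    exact Real.rpow_le_rpow (mul_nonneg (by linarith) ha) (by linarith) hp.le
  have h5 : a ^ p ≤ R ^ p := Real.rpow_le_rpow ha haR hp.le
  have h6 : 1 ≤ (1 + ε) ^ p := Real.one_le_rpow (by linarith) hp.le
  have h7 : (1 - ε) ^ p ≤ 1 := Real.rpow_le_one (by linarith) (by linarith) hp.le
  rw [abs_le]
  constructor <;> nlinarith

/-- If the distances `‖x i - x j‖ ^ p` can be varied independently by moving `x` along `J`,
then `x` embeds isometrically into every space that contains `X` in the sense of
approximable norms. -/
theorem exists_isometry_of_surjective [FiniteDimensional ℝ E] {Z X : Type*} [NormedAddCommGroup Z]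
    [NormedSpace ℝ Z] [NormedAddCommGroup X] [NormedSpace ℝ X]
    (hX : (fun x : X => ‖x‖) ∈ approxNorms Z X) {p : ℝ} (hp : 1 ≤ p) {n : ℕ} (x : Fin n → X)
    (J : E →L[ℝ] (Fin n → X)) {A : E →L[ℝ] (PairIdx n → ℝ)}
    (hA : HasStrictFDerivAt (fun (y : E) (q : PairIdx n) =>
      ‖x q.1.1 - x q.1.2 + (J y q.1.1 - J y q.1.2)‖ ^ p) A 0) (hsurj : Function.Surjective A) :
    ∃ f : Fin n → Z, ∀ i j, dist (f i) (f j) = dist (x i) (x j) := by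
  have hp0 : 0 < p := by linarith
  have := FiniteDimensional.complete ℝ E
  obtain ⟨r, hr, δ, hδ, hmain⟩ := hA.exists_eq_of_convex_close hsurj
  obtain ⟨ε, hε, hclose⟩ := exists_abs_rpow_sub_rpow_le (R := 2 * (‖x‖ + ‖J‖ * r)) hp0
    hδ
  let L : (Fin n → ℝ) × (Fin n → E) →ₗ[ℝ] X :=
    (Fintype.linearCombination ℝ x).comp (LinearMap.fst ℝ _ _) +
      (∑ i, (LinearMap.proj i ∘ₗ (J : E →ₗ[ℝ] (Fin n → X))) ∘ₗ LinearMap.proj i).comp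
        (LinearMap.snd ℝ _ _)
  have hL (i : Fin n) (y : E) : L (Pi.single i 1, Pi.single i y) = x i + J y i := by
    simp only [L, LinearMap.add_apply, LinearMap.comp_apply, LinearMap.fst_apply,
      LinearMap.snd_apply, LinearMap.sum_apply, LinearMap.proj_apply,
      Fintype.linearCombination_apply_single, one_smul]
    congr 1
    rw [sum_eq_single_of_mem i (mem_univ i)]
    · simp
    · intro j _ hj
      simp [Pi.single_eq_of_ne hj]
  obtain ⟨T, hT⟩ := exists_linearMap_abs_norm_sub_le
    (approxNorms.comp hX (LinearMap.range L).subtype) hε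
  let T' := T ∘ₗ L.rangeRestrict
  have hT' (w) : |‖T' w‖ - ‖L w‖| ≤ ε * ‖L w‖ := hT (L.rangeRestrict w)
  let U (i : Fin n) (y : E) : (Fin n → ℝ) × (Fin n → E) := (Pi.single i 1, Pi.single i y)
  have hLU (i j : Fin n) (y : E) : L (U i y - U j y) = x i - x j + (J y i - J y j) := by
    rw [map_sub, hL, hL]
    abel
  suffices h : ∃ y, (fun q : PairIdx n => ‖T' (U q.1.1 y - U q.1.2 y)‖ ^ p) =
      fun q : PairIdx n => ‖x q.1.1 - x q.1.2 + (J 0 q.1.1 - J 0 q.1.2)‖ ^ p by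
    obtain ⟨y, hy⟩ := h
    refine ⟨fun i => T' (U i y), fun i j => ?_⟩
    have key (i j : Fin n) (hij : i < j) : dist (T' (U i y)) (T' (U j y)) = dist (x i) (x j) := by
      have := congr_fun hy ⟨(i, j), hij⟩
      simp only [map_zero, Pi.zero_apply, sub_zero, add_zero] at this
      rw [dist_eq_norm, dist_eq_norm, ← map_sub]
      exact (Real.rpow_left_inj (norm_nonneg _) (norm_nonneg _) hp0.ne').1 this
    rcases lt_trichotomy i j with hij | rfl | hij
    · exact key i j hij
    · simp
    · rw [dist_comm, dist_comm (x i)]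
      exact key j i hij
  refine hmain (fun y q => ‖T' (U q.1.1 y - U q.1.2 y)‖ ^ p) (fun q => ?_) (fun y hy q => ?_)
  · convert convexOn_norm_add_rpow hp (T' (Pi.single q.1.1 1 - Pi.single q.1.2 1, 0))
      (T' ∘ₗ LinearMap.inr ℝ (Fin n → ℝ) (Fin n → E) ∘ₗ
        (LinearMap.single ℝ (fun _ => E) q.1.1 - LinearMap.single ℝ (fun _ => E) q.1.2)) using 4
      with y
    simp only [LinearMap.comp_apply, ← map_add]
    simp [U]
  · rw [← hLU]
    refine hclose _ _ (norm_nonneg _) ?_ (norm_nonneg _) (hT' _)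
    rw [hLU]
    have h1 (i : Fin n) : ‖x i‖ ≤ ‖x‖ := norm_le_pi_norm x i
    have h2 (i : Fin n) : ‖J y i‖ ≤ ‖J‖ * r :=
      (norm_le_pi_norm (J y) i).trans ((J.le_opNorm y).trans (by gcongr))
    calc _ ≤ ‖x q.1.1‖ + ‖x q.1.2‖ + (‖J y q.1.1‖ + ‖J y q.1.2‖) :=
          (norm_add_le _ _).trans (add_le_add (norm_sub_le _ _) (norm_sub_le _ _))
      _ ≤ _ := by linarith [h1 q.1.1, h1 q.1.2, h2 q.1.1, h2 q.1.2]

end Perturbation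

section Degenerate

/-- The derivative of `t ↦ |t| ^ p`. -/
def absRpowDeriv (p t : ℝ) : ℝ := p * |t| ^ (p - 2) * t

lemma hasStrictDerivAt_abs_rpow {p : ℝ} (hp : 1 < p) (t : ℝ) :
    HasStrictDerivAt (fun t : ℝ => |t| ^ p) (absRpowDeriv p t) t := by
  have h1 : ContDiff ℝ 1 fun t : ℝ => |t| ^ p := contDiff_norm_rpow (E := ℝ) hp
  have h2 := h1.contDiffAt.hasStrictDerivAt (x := t) one_ne_zero
  rwa [(hasDerivAt_abs_rpow t hp).deriv] at h2

lemma continuous_absRpowDeriv {p : ℝ} (hp : 1 < p) : Continuous (absRpowDeriv p) := by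
  have h1 : ContDiff ℝ 1 fun t : ℝ => |t| ^ p := contDiff_norm_rpow (E := ℝ) hp
  have h2 : deriv (fun t : ℝ => |t| ^ p) = absRpowDeriv p :=
    funext fun t => (hasDerivAt_abs_rpow t hp).deriv
  exact h2 ▸ h1.continuous_deriv le_rfl

lemma strictMono_absRpowDeriv {p : ℝ} (hp : 1 < p) : StrictMono (absRpowDeriv p) := by
  refine strictMono_of_odd_strictMonoOn_nonneg (fun t => by simp [absRpowDeriv]) ?_
  have h (t : ℝ) (ht : 0 ≤ t) : absRpowDeriv p t = p * t ^ (p - 1) := by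
    rcases ht.eq_or_lt with rfl | ht
    · simp [absRpowDeriv, Real.zero_rpow (by linarith : p - 1 ≠ 0)]
    · rw [absRpowDeriv, abs_of_pos ht, mul_assoc, ← Real.rpow_add_one ht.ne']
      ring_nf
  intro s hs t ht hst
  rw [h s hs, h t ht]
  exact mul_lt_mul_of_pos_left (Real.rpow_lt_rpow hs hst (by linarith)) (by linarith)

variable {n : ℕ}

/-- The transpose of the derivative of `w ↦ (|w i - w j| ^ p)_{i < j}`. -/
def pairMap (p : ℝ) (w : Fin n → ℝ) : (PairIdx n → ℝ) →ₗ[ℝ] (Fin n → ℝ) :=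
  Fintype.linearCombination ℝ fun q =>
    absRpowDeriv p (w q.1.1 - w q.1.2) • (Pi.single q.1.1 1 - Pi.single q.1.2 1)

lemma dotProduct_pairMap (p : ℝ) (w u : Fin n → ℝ) (l : PairIdx n → ℝ) :
    u ⬝ᵥ pairMap p w l =
      ∑ q, l q * (absRpowDeriv p (w q.1.1 - w q.1.2) * (u q.1.1 - u q.1.2)) := by
  simp [pairMap, Fintype.linearCombination_apply, dotProduct_sum, dotProduct_smul, dotProduct_sub]

lemma continuous_pairMap {p : ℝ} (hp : 1 < p) :
    Continuous fun x : (Fin n → ℝ) × (PairIdx n → ℝ) => pairMap p x.1 x.2 := by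
  have := continuous_absRpowDeriv hp
  simp only [pairMap, Fintype.linearCombination_apply]
  fun_prop

lemma eq_of_pairMap_eq_zero {p : ℝ} (hp : 1 < p) {l : PairIdx n → ℝ} {i j : Fin n} {hij : i < j}
    (hq : l ⟨(i, j), hij⟩ ≠ 0) {w w' : Fin n → ℝ} (hw : pairMap p w l = 0)
    (hw' : pairMap p w' l = 0) (h : ∀ k, k ≠ j → w k = w' k) : w j = w' j := by
  have h1 := dotProduct_pairMap p w (Pi.single i 1) l
  have h1' := dotProduct_pairMap p w' (Pi.single i 1) l
  rw [hw, dotProduct_zero] at h1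
  rw [hw', dotProduct_zero, h1, ← sub_eq_zero, ← sum_sub_distrib,
    sum_eq_single_of_mem ⟨(i, j), hij⟩ (mem_univ _)] at h1'
  · rw [← mul_sub, mul_eq_zero, or_iff_right hq, ← sub_mul] at h1'
    simp only [Pi.single_eq_same, Pi.single_eq_of_ne hij.ne', sub_zero, mul_one, h i hij.ne] at h1'
    have := (strictMono_absRpowDeriv hp).injective (sub_eq_zero.1 h1')
    linarith
  · rintro ⟨⟨i', j'⟩, hij'⟩ - hne
    have hne' : ¬ (i' = i ∧ j' = j) := by
      rintro ⟨rfl, rfl⟩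
      exact hne rfl
    simp only at hij' ⊢
    by_cases hi : i' = i
    · subst hi
      have hj : j' ≠ j := fun h => hne' ⟨rfl, h⟩
      rw [h i' hij.ne, h j' hj, sub_self]
    · by_cases hj : j' = i
      · subst hj
        rw [h i' (hij'.trans hij).ne, h j' hij.ne, sub_self]
      · simp [Pi.single_eq_of_ne hi, Pi.single_eq_of_ne hj]

lemma ae_pairMap_ne_zero {p : ℝ} (hp : 1 < p) {l : PairIdx n → ℝ} (hl : l ≠ 0) :
    ∀ᵐ w : Fin n → ℝ, pairMap p w l ≠ 0 := by
  obtain ⟨⟨⟨i, j⟩, hij⟩, hq⟩ := Function.ne_iff.1 hl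
  have hmeas : MeasurableSet {w : Fin n → ℝ | pairMap p w l ≠ 0} :=
    (isOpen_compl_singleton.preimage ((continuous_pairMap hp).comp
      (by fun_prop : Continuous fun w : Fin n → ℝ => (w, l)))).measurableSet
  refine ae_mem_of_ae_add_linearMap_mem (LinearMap.single ℝ (fun _ : Fin n => ℝ) j)
    (volume : Measure ℝ) volume hmeas fun w => ?_
  have hsub : Set.Subsingleton {t : ℝ | ¬ pairMap p (w + LinearMap.single ℝ _ j t) l ≠ 0} := by
    intro s hs t ht
    have hs' : pairMap p (w + LinearMap.single ℝ _ j s) l = 0 := not_not.1 hs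
    have ht' : pairMap p (w + LinearMap.single ℝ _ j t) l = 0 := not_not.1 ht
    have := eq_of_pairMap_eq_zero hp hq hs' ht' fun k hk => by simp [Pi.single_eq_of_ne hk]
    simpa using this
  exact hsub.finite.measure_zero _

/-- The `w` for which some nonzero element of `K` annihilates the derivative of the distances. -/
def degenerateSet (p : ℝ) (M : ℕ) (K : Submodule ℝ (PairIdx n → ℝ)) : Set (Fin M → Fin n → ℝ) :=
  {w | ∃ l ∈ K, l ≠ 0 ∧ ∀ k, pairMap p (w k) l = 0}

lemma degenerateSet_bot (p : ℝ) (M : ℕ) :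
    degenerateSet p M (⊥ : Submodule ℝ (PairIdx n → ℝ)) = ∅ := by
  ext w
  simp [degenerateSet]

lemma isClosed_degenerateSet {p : ℝ} (hp : 1 < p) (M : ℕ) (K : Submodule ℝ (PairIdx n → ℝ)) :
    IsClosed (degenerateSet p M K) := by
  let S : Set (PairIdx n → ℝ) := Metric.sphere 0 1
  have : CompactSpace S := isCompact_iff_compactSpace.1 (isCompact_sphere _ _)
  let D : Set (S × (Fin M → Fin n → ℝ)) :=
    {x | (x.1 : PairIdx n → ℝ) ∈ K ∧ ∀ k, pairMap p (x.2 k) x.1 = 0}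
  have hD : IsClosed D := by
    have h : D = {x | (x.1 : PairIdx n → ℝ) ∈ K} ∩ ⋂ k, {x | pairMap p (x.2 k) x.1 = 0} := by
      ext x
      simp [D]
    rw [h]
    refine (K.closed_of_finiteDimensional.preimage (by fun_prop)).inter ?_
    exact isClosed_iInter fun k => isClosed_singleton.preimage ((continuous_pairMap hp).comp
      (by fun_prop : Continuous fun x : S × (Fin M → Fin n → ℝ) => (x.2 k, x.1.1)))
  have h : degenerateSet p M K = Prod.snd '' D := by
    ext w
    constructor
    · rintro ⟨l, hl, hl0, hw⟩
      have h1 : ‖‖l‖⁻¹ • l‖ = 1 := by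
        rw [norm_smul, norm_inv, norm_norm, inv_mul_cancel₀ (norm_ne_zero_iff.2 hl0)]
      refine ⟨(⟨‖l‖⁻¹ • l, by simpa [S] using h1⟩, w), ⟨K.smul_mem _ hl, fun k => ?_⟩, rfl⟩
      simp [hw k]
    · rintro ⟨⟨⟨l, hl⟩, w⟩, ⟨hlK, hw⟩, rfl⟩
      refine ⟨l, hlK, ?_, hw⟩
      rintro rfl
      simp [S] at hl
  rw [h]
  exact isClosedMap_snd_of_compactSpace _ hD

lemma volume_degenerateSet {p : ℝ} (hp : 1 < p) (M : ℕ) (K : Submodule ℝ (PairIdx n → ℝ))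
    (hK : Module.finrank ℝ K ≤ M) : volume (degenerateSet p M K) = 0 := by
  induction M generalizing K with
  | zero =>
    have : K = ⊥ := Submodule.finrank_eq_zero.1 (by omega)
    subst this
    rw [degenerateSet_bot, measure_empty]
  | succ M ih =>
    rcases eq_or_ne K ⊥ with rfl | hne
    · rw [degenerateSet_bot, measure_empty]
    obtain ⟨l, hl, hl0⟩ := K.exists_mem_ne_zero_of_ne_bot hne
    have hmp := (volume_preserving_piFinSuccAbove (fun _ : Fin (M + 1) => Fin n → ℝ) 0).symm
    rw [← hmp.measure_preimage
      (isClosed_degenerateSet hp _ K).measurableSet.nullMeasurableSet]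
    refine (Measure.measure_prod_null
      (hmp.measurable (isClosed_degenerateSet hp _ K).measurableSet)).2 ?_
    filter_upwards [ae_pairMap_ne_zero hp hl0] with w hw
    have hlt : K ⊓ LinearMap.ker (pairMap p w) < K := by
      refine inf_le_left.lt_of_ne fun h => hw ?_
      rw [← h] at hl
      exact hl.2
    refine measure_mono_null ?_ (ih (K ⊓ LinearMap.ker (pairMap p w))
      (by have := Submodule.finrank_lt_finrank_of_lt hlt; omega))
    rintro w' ⟨l', hl', hl0', hw'⟩
    refine ⟨l', ⟨hl', ?_⟩, hl0', fun k => ?_⟩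
    · simpa using hw' 0
    · simpa using hw' k.succ

end Degenerate

/-! ### Perturbing finitely many coordinates of a tuple in `ℓ_p` -/

/-- Insertion of `M` blocks of coordinates into an `n`-tuple of sequences. -/
def insertCoords (r : ℝ≥0∞) [Fact (1 ≤ r)] (M n : ℕ) :
    (Fin M → Fin n → ℝ) →L[ℝ] (Fin n → lp (fun _ : ℕ => ℝ) r) :=
  ContinuousLinearMap.pi fun i => ∑ k : Fin M,
    (lp.singleContinuousLinearMap ℝ (fun _ : ℕ => ℝ) r (k : ℕ)) ∘L
      (ContinuousLinearMap.proj (R := ℝ) (φ := fun _ : Fin n => ℝ) i) ∘L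
      (ContinuousLinearMap.proj (R := ℝ) (φ := fun _ : Fin M => Fin n → ℝ) k)

/-- The first `M` coordinates of an `n`-tuple of sequences. -/
def firstCoords (r : ℝ≥0∞) [Fact (1 ≤ r)] (M n : ℕ) :
    (Fin n → lp (fun _ : ℕ => ℝ) r) →L[ℝ] (Fin M → Fin n → ℝ) :=
  ContinuousLinearMap.pi fun k => ContinuousLinearMap.pi fun i =>
    (lp.evalCLM ℝ (fun _ : ℕ => ℝ) r (k : ℕ)) ∘L
      (ContinuousLinearMap.proj (R := ℝ) (φ := fun _ : Fin n => lp (fun _ : ℕ => ℝ) r) i)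

section coordinates

variable {r : ℝ≥0∞} [Fact (1 ≤ r)] {M n : ℕ}

lemma firstCoords_apply (x : Fin n → lp (fun _ : ℕ => ℝ) r) (k : Fin M) (i : Fin n) :
    firstCoords r M n x k i = x i k := rfl

lemma insertCoords_apply (w : Fin M → Fin n → ℝ) (i : Fin n) (m : ℕ) :
    insertCoords r M n w i m = ∑ k : Fin M, (Pi.single (k : ℕ) (w k i) : ℕ → ℝ) m := by
  have h : insertCoords r M n w i = ∑ k : Fin M, lp.single r (k : ℕ) (w k i) := by
    simp [insertCoords, lp.singleContinuousLinearMap_apply]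
  rw [h, lp.coeFn_sum, Finset.sum_apply]
  rfl

lemma insertCoords_apply_val (w : Fin M → Fin n → ℝ) (i : Fin n) (k : Fin M) :
    insertCoords r M n w i (k : ℕ) = w k i := by
  rw [insertCoords_apply, Finset.sum_eq_single k]
  · simp
  · intro j _ hj
    exact Pi.single_eq_of_ne (fun h => hj (Fin.ext h.symm)) _
  · simp

lemma insertCoords_apply_of_le (w : Fin M → Fin n → ℝ) (i : Fin n) {m : ℕ} (hm : M ≤ m) :
    insertCoords r M n w i m = 0 := by
  rw [insertCoords_apply]
  refine Finset.sum_eq_zero fun k _ => Pi.single_eq_of_ne ?_ _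
  have := k.2
  omega

lemma firstCoords_insertCoords (w : Fin M → Fin n → ℝ) :
    firstCoords r M n (insertCoords r M n w) = w := by
  ext k i
  rw [firstCoords_apply, insertCoords_apply_val]

end coordinates

lemma lp_norm_rpow_eq_of_eq_of_le {r : ℝ≥0∞} (hr : 0 < r.toReal) {M : ℕ}
    {f g : lp (fun _ : ℕ => ℝ) r} (h : ∀ m, M ≤ m → g m = f m) :
    ‖g‖ ^ r.toReal = ‖f‖ ^ r.toReal - ∑ k : Fin M, |f k| ^ r.toReal
      + ∑ k : Fin M, |g k| ^ r.toReal := by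
  have h1 := (lp.hasSum_norm hr g).sub (lp.hasSum_norm hr f)
  have h2 := hasSum_sum_of_ne_finset_zero
    (f := fun m => ‖g m‖ ^ r.toReal - ‖f m‖ ^ r.toReal) (s := Finset.range M)
    (L := SummationFilter.unconditional ℕ) (fun m hm => by
      rw [h m (by simpa using hm), sub_self])
  have h3 := h1.unique h2
  simp only [Real.norm_eq_abs] at h3
  rw [Finset.sum_sub_distrib, ← Fin.sum_univ_eq_sum_range (fun m => |g m| ^ r.toReal),
    ← Fin.sum_univ_eq_sum_range (fun m => |f m| ^ r.toReal)] at h3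
  linarith

/-- The derivative at `0` of the `p`-th powers of mutual distances under perturbations of
coordinates `w`. -/
def distPowDeriv (p : ℝ) {M n : ℕ} (w : Fin M → Fin n → ℝ) :
    (Fin M → Fin n → ℝ) →L[ℝ] (PairIdx n → ℝ) :=
  ContinuousLinearMap.pi fun q => ∑ k : Fin M, absRpowDeriv p (w k q.1.1 - w k q.1.2) •
    ((ContinuousLinearMap.proj (R := ℝ) (φ := fun _ : Fin n => ℝ) q.1.1 -
      ContinuousLinearMap.proj (R := ℝ) (φ := fun _ : Fin n => ℝ) q.1.2) ∘L
      (ContinuousLinearMap.proj (R := ℝ) (φ := fun _ : Fin M => Fin n → ℝ) k))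

lemma distPowDeriv_apply (p : ℝ) {M n : ℕ} (w u : Fin M → Fin n → ℝ) (q : PairIdx n) :
    distPowDeriv p w u q =
      ∑ k, absRpowDeriv p (w k q.1.1 - w k q.1.2) * (u k q.1.1 - u k q.1.2) := by
  simp [distPowDeriv]

lemma hasStrictFDerivAt_dist_rpow {p : ℝ} (hp : 1 < p) [Fact (1 ≤ ENNReal.ofReal p)]
    {M n : ℕ} (x : Fin n → lp (fun _ : ℕ => ℝ) (ENNReal.ofReal p)) :
    HasStrictFDerivAt (fun (y : Fin M → Fin n → ℝ) (q : PairIdx n) =>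
      ‖x q.1.1 - x q.1.2 + (insertCoords (ENNReal.ofReal p) M n y q.1.1 -
        insertCoords (ENNReal.ofReal p) M n y q.1.2)‖ ^ p)
      (distPowDeriv p (firstCoords (ENNReal.ofReal p) M n x)) 0 := by
  have hr : (ENNReal.ofReal p).toReal = p := ENNReal.toReal_ofReal (by linarith)
  rw [hasStrictFDerivAt_pi']
  intro q
  have key : (fun y : Fin M → Fin n → ℝ =>
      ‖x q.1.1 - x q.1.2 + (insertCoords (ENNReal.ofReal p) M n y q.1.1 -
        insertCoords (ENNReal.ofReal p) M n y q.1.2)‖ ^ p) = fun y =>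
      (‖x q.1.1 - x q.1.2‖ ^ p - ∑ k : Fin M, |(x q.1.1 - x q.1.2) k| ^ p) +
        ∑ k : Fin M, |x q.1.1 k - x q.1.2 k + (y k q.1.1 - y k q.1.2)| ^ p := by
    funext y
    have := lp_norm_rpow_eq_of_eq_of_le (r := ENNReal.ofReal p) (M := M) (by rw [hr]; linarith)
      (f := x q.1.1 - x q.1.2)
      (g := x q.1.1 - x q.1.2 + (insertCoords (ENNReal.ofReal p) M n y q.1.1 -
        insertCoords (ENNReal.ofReal p) M n y q.1.2)) (fun m hm => by
          simp [insertCoords_apply_of_le _ _ hm])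
    rw [hr] at this
    rw [this]
    congr 1
    refine Finset.sum_congr rfl fun k _ => ?_
    simp [insertCoords_apply_val]
  rw [key]
  refine HasStrictFDerivAt.const_add _ ?_
  have hk : ∀ k : Fin M, HasStrictFDerivAt
      (fun y : Fin M → Fin n → ℝ => |x q.1.1 k - x q.1.2 k + (y k q.1.1 - y k q.1.2)| ^ p)
      (absRpowDeriv p (x q.1.1 k - x q.1.2 k) •
        ((ContinuousLinearMap.proj (R := ℝ) (φ := fun _ : Fin n => ℝ) q.1.1 -
          ContinuousLinearMap.proj (R := ℝ) (φ := fun _ : Fin n => ℝ) q.1.2) ∘L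
          (ContinuousLinearMap.proj (R := ℝ) (φ := fun _ : Fin M => Fin n → ℝ) k))) 0 := by
    intro k
    have hL := (((ContinuousLinearMap.proj (R := ℝ) (φ := fun _ : Fin n => ℝ) q.1.1 -
          ContinuousLinearMap.proj (R := ℝ) (φ := fun _ : Fin n => ℝ) q.1.2) ∘L
          (ContinuousLinearMap.proj (R := ℝ)
            (φ := fun _ : Fin M => Fin n → ℝ) k)).hasStrictFDerivAt (x := 0)).const_add
              (x q.1.1 k - x q.1.2 k)
    refine HasStrictDerivAt.comp_hasStrictFDerivAt (h₂ := fun t : ℝ => |t| ^ p) 0 ?_ hL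
    simpa using hasStrictDerivAt_abs_rpow hp (x q.1.1 k - x q.1.2 k)
  have hsum := HasStrictFDerivAt.fun_sum (u := Finset.univ) fun k _ => hk k
  convert hsum using 1
  ext u
  simp [distPowDeriv_apply, firstCoords_apply]

lemma surjective_distPowDeriv {p : ℝ} {M n : ℕ} {w : Fin M → Fin n → ℝ}
    (hw : w ∉ degenerateSet p M (⊤ : Submodule ℝ (PairIdx n → ℝ))) :
    Function.Surjective (distPowDeriv p w) := by
  by_contra hsurj
  have hlt : LinearMap.range (distPowDeriv p w).toLinearMap < ⊤ :=
    lt_top_iff_ne_top.2 fun h => hsurj (LinearMap.range_eq_top.1 h)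
  obtain ⟨f, hf0, hf⟩ := Submodule.exists_le_ker_of_lt_top _ hlt
  set l : PairIdx n → ℝ := fun q => f (Pi.single q 1) with hl
  have hfl : ∀ v : PairIdx n → ℝ, f v = ∑ q, l q * v q := by
    intro v
    conv_lhs => rw [LinearMap.pi_apply_eq_sum_univ f v]
    refine Finset.sum_congr rfl fun q _ => ?_
    rw [smul_eq_mul, mul_comm]
    simp only [hl]
    congr 2
    ext q'
    simp [Pi.single_apply, eq_comm]
  refine hw ⟨l, trivial, ?_, fun k => ?_⟩
  · intro h0
    apply hf0
    ext v
    simp [hfl, h0]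
  · have hdot : ∀ u : Fin n → ℝ, u ⬝ᵥ pairMap p (w k) l = 0 := by
      intro u
      rw [dotProduct_pairMap]
      have h1 : f (distPowDeriv p w (Pi.single k u)) = 0 := hf ⟨Pi.single k u, rfl⟩
      rw [hfl] at h1
      rw [← h1]
      refine Finset.sum_congr rfl fun q _ => ?_
      rw [distPowDeriv_apply, Finset.sum_eq_single k]
      · simp
      · intro j _ hj
        simp [Pi.single_eq_of_ne hj]
      · simp
    exact dotProduct_self_eq_zero.1 (hdot _)

/-! ### Sets of tuples with null sections -/

section small

variable {r : ℝ≥0∞} [Fact (1 ≤ r)] {M n : ℕ} {D : Set (Fin M → Fin n → ℝ)}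

lemma isNowhereDense_preimage_firstCoords (hD : IsClosed D) (h0 : volume D = 0) :
    IsNowhereDense (firstCoords r M n ⁻¹' D) := by
  have hcl : IsClosed (firstCoords r M n ⁻¹' D) := hD.preimage (firstCoords r M n).continuous
  rw [hcl.isNowhereDense_iff, Set.eq_empty_iff_forall_notMem]
  intro x hx
  set U := (fun w => x + insertCoords r M n w) ⁻¹' interior (firstCoords r M n ⁻¹' D)
  have hU : IsOpen U := isOpen_interior.preimage (by fun_prop)
  have hne : U.Nonempty := ⟨0, by simpa [U] using hx⟩
  have hsub : U ⊆ (fun w => firstCoords r M n x + w) ⁻¹' D := by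
    intro w hw
    have := interior_subset hw
    simpa [firstCoords_insertCoords] using this
  have hpos := hU.measure_pos volume hne
  have : volume ((fun w => firstCoords r M n x + w) ⁻¹' D) = 0 := by
    rw [measure_preimage_add, h0]
  exact hpos.ne' (measure_mono_null hsub this)

lemma haarNull_of_subset_preimage_firstCoords
    [MeasurableSpace (Fin n → lp (fun _ : ℕ => ℝ) r)]
    [BorelSpace (Fin n → lp (fun _ : ℕ => ℝ) r)]
    (hD : IsClosed D) (h0 : volume D = 0)
    {B : Set (Fin n → lp (fun _ : ℕ => ℝ) r)} (hB : B ⊆ firstCoords r M n ⁻¹' D) :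
    HaarNull B := by
  have hmeas : Measurable (insertCoords r M n) := (insertCoords r M n).continuous.measurable
  set ν : Measure (Fin M → Fin n → ℝ) :=
    ProbabilityTheory.cond volume (Metric.ball (0 : Fin M → Fin n → ℝ) 1) with hν
  have hprob : IsProbabilityMeasure ν :=
    ProbabilityTheory.cond_isProbabilityMeasure_of_finite
      (Metric.measure_ball_pos volume _ one_pos).ne' measure_ball_lt_top.ne
  refine ⟨Measure.map (insertCoords r M n) ν,
    Measure.isProbabilityMeasure_map hmeas.aemeasurable, fun x => ?_⟩
  set T := (fun y => firstCoords r M n y - firstCoords r M n x) ⁻¹' D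
  have hT : IsClosed T := hD.preimage (by fun_prop)
  have hsub : (fun a => x + a) '' B ⊆ T := by
    rintro _ ⟨b, hb, rfl⟩
    have := hB hb
    simpa [T] using this
  refine measure_mono_null hsub ?_
  rw [Measure.map_apply hmeas hT.measurableSet]
  refine ProbabilityTheory.cond_absolutelyContinuous ?_
  have : insertCoords r M n ⁻¹' T = (fun w => w - firstCoords r M n x) ⁻¹' D := by
    ext w
    simp [T, firstCoords_insertCoords]
  simp only [this, sub_eq_add_neg]
  rw [measure_preimage_add_right, h0]

end small

theorem isNowhereDense_and_haarNull_not_isometric {p : ℝ} (hp : 1 < p)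
    [Fact (1 ≤ ENNReal.ofReal p)] (n : ℕ)
    {Z : Type*} [NormedAddCommGroup Z] [NormedSpace ℝ Z]
    (hZ : UnifContainsLp (ENNReal.ofReal p) Z)
    [MeasurableSpace (Fin n → lp (fun _ : ℕ => ℝ) (ENNReal.ofReal p))]
    [BorelSpace (Fin n → lp (fun _ : ℕ => ℝ) (ENNReal.ofReal p))] :
    IsNowhereDense {x : Fin n → lp (fun _ : ℕ => ℝ) (ENNReal.ofReal p) |
        ¬ ∃ f : Fin n → Z, ∀ i j, dist (f i) (f j) = dist (x i) (x j)} ∧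
    HaarNull {x : Fin n → lp (fun _ : ℕ => ℝ) (ENNReal.ofReal p) |
        ¬ ∃ f : Fin n → Z, ∀ i j, dist (f i) (f j) = dist (x i) (x j)} := by
  set M := Module.finrank ℝ (PairIdx n → ℝ) with hM
  set D := degenerateSet p M (⊤ : Submodule ℝ (PairIdx n → ℝ)) with hDdef
  have hD : IsClosed D := isClosed_degenerateSet hp M _
  have h0 : volume D = 0 := volume_degenerateSet hp M _ (by rw [finrank_top])
  have hsub : {x : Fin n → lp (fun _ : ℕ => ℝ) (ENNReal.ofReal p) |
        ¬ ∃ f : Fin n → Z, ∀ i j, dist (f i) (f j) = dist (x i) (x j)} ⊆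
      firstCoords (ENNReal.ofReal p) M n ⁻¹' D := by
    intro x hx
    by_contra hxD
    have hX := norm_mem_approxNorms_lp hp hZ
    have hA := hasStrictFDerivAt_dist_rpow (M := M) hp x
    have hs := surjective_distPowDeriv hxD
    exact hx (exists_isometry_of_surjective hX hp.le x
      (insertCoords (ENNReal.ofReal p) M n) hA hs)
  exact ⟨(isNowhereDense_preimage_firstCoords hD h0).mono hsub,
    haarNull_of_subset_preimage_firstCoords hD h0 hsub⟩

end

/-- For `1 < p < ∞`, if `Z` is a Banach space uniformly containing the
spaces `ℓ_p^m`, then the set of `n`-tuples of points of `ℓ_p` that do not embed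
isometrically into `Z` is nowhere dense and Haar null in `(ℓ_p)^n`. -/
theorem stmt0 (p : ℝ) (hp : 1 < p) [Fact (1 ≤ ENNReal.ofReal p)] (n : ℕ)
    (Z : Type*) [NormedAddCommGroup Z] [NormedSpace ℝ Z] [CompleteSpace Z]
    (hZ : UnifContainsLp (ENNReal.ofReal p) Z)
    [MeasurableSpace (Fin n → lp (fun _ : ℕ => ℝ) (ENNReal.ofReal p))]
    [BorelSpace (Fin n → lp (fun _ : ℕ => ℝ) (ENNReal.ofReal p))] :
    IsNowhereDense {x : Fin n → lp (fun _ : ℕ => ℝ) (ENNReal.ofReal p) |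
        ¬ ∃ f : Fin n → Z, ∀ i j, dist (f i) (f j) = dist (x i) (x j)} ∧
    HaarNull {x : Fin n → lp (fun _ : ℕ => ℝ) (ENNReal.ofReal p) |
        ¬ ∃ f : Fin n → Z, ∀ i j, dist (f i) (f j) = dist (x i) (x j)} := by
  exact isNowhereDense_and_haarNull_not_isometric hp n hZ
end
end

section
/- Fix n ∈ ℕ and 1 < p < ∞. For Lebesgue-almost every n-tuple (x_1,…,x_n) ∈ (ℝ^n)^n there exists ε > 0 such that every metric space on n points (y_1,…,y_n) satisfying |d(y_i,y_j) − ‖x_i − x_j‖_p| < ε for all 1 ≤ i,j ≤ n embeds isometrically into ℓ_p^n. -/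
open MeasureTheory
open scoped ENNReal
noncomputable section

-- test lp coercion and instances

theorem ae_det_ne_zero (n : ℕ) :
    ∀ᵐ A : Fin n → Fin n → ℝ ∂volume, (Matrix.of A).det ≠ 0 := by
  let L : ℝ →ₗ[ℝ] (Fin n → Fin n → ℝ) :=
    LinearMap.toSpanSingleton ℝ _ (fun i j => (1 : Matrix (Fin n) (Fin n) ℝ) i j)
  have hs : IsOpen {A : Fin n → Fin n → ℝ | (Matrix.of A).det ≠ 0} := by
    refine isOpen_ne_fun ?_ continuous_const
    exact Continuous.matrix_det (A := fun A : Fin n → Fin n → ℝ => Matrix.of A) continuous_id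
  refine ae_mem_of_ae_add_linearMap_mem L volume volume hs.measurableSet fun A => ?_
  have hfin : {t : ℝ | (-Matrix.of A).charpoly.IsRoot t}.Finite :=
    Polynomial.finite_setOfPred_isRoot (Matrix.charpoly_monic _).ne_zero
  filter_upwards [measure_eq_zero_iff_ae_notMem.1 (hfin.measure_zero volume)] with t ht
  have h : Matrix.of (A + L t) = Matrix.scalar _ t - (-Matrix.of A) := by
    ext i j
    simp [L, Matrix.one_apply, Matrix.diagonal_apply, add_comm]
  change (Matrix.of (A + L t)).det ≠ 0
  rw [h, ← Matrix.eval_charpoly]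
  exact ht

/-- The signed power `|t| ^ (r - 1) * t`. -/
def signedPow (r t : ℝ) : ℝ := |t| ^ (r - 1) * t

theorem abs_signedPow {r t : ℝ} (ht : t ≠ 0) : |signedPow r t| = |t| ^ r := by
  have h := abs_pos.2 ht
  rw [signedPow, abs_mul, abs_of_nonneg (by positivity), Real.rpow_sub_one h.ne']
  field_simp

theorem signedPow_inv_signedPow {r t : ℝ} (hr : r ≠ 0) (ht : t ≠ 0) :
    signedPow r⁻¹ (signedPow r t) = t := by
  have h := abs_pos.2 ht
  rw [signedPow, abs_signedPow ht, signedPow, ← Real.rpow_mul h.le, ← mul_assoc,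
    ← Real.rpow_add h, mul_sub, mul_inv_cancel₀ hr]
  simp

theorem signedPow_ne_zero {r t : ℝ} (ht : t ≠ 0) : signedPow r t ≠ 0 :=
  mul_ne_zero (Real.rpow_pos_of_pos (abs_pos.2 ht) _).ne' ht

theorem signedPow_neg (r t : ℝ) : signedPow r (-t) = -signedPow r t := by
  simp [signedPow]

theorem differentiableAt_signedPow {r t : ℝ} (ht : t ≠ 0) :
    DifferentiableAt ℝ (signedPow r) t :=
  ((differentiableAt_abs ht).rpow_const (Or.inl (abs_pos.2 ht).ne')).mul differentiableAt_id

theorem ae_entries_ne_zero (n : ℕ) :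
    ∀ᵐ z : Fin n → Fin n → ℝ ∂volume, ∀ i j, z i j ≠ 0 := by
  rw [ae_all_iff]
  intro i
  rw [ae_all_iff]
  intro j
  have h : ∀ᵐ t : ℝ ∂volume, t ≠ 0 := Measure.ae_ne volume 0
  exact (Measure.quasiMeasurePreserving_eval (fun _ : Fin n => (volume : Measure (Fin n → ℝ))) i).ae
    ((Measure.quasiMeasurePreserving_eval (fun _ : Fin n => (volume : Measure ℝ)) j).ae h)

theorem ae_det_signedPow_ne_zero {r : ℝ} (hr : r ≠ 0) (n : ℕ) :
    ∀ᵐ z : Fin n → Fin n → ℝ ∂volume,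
      (Matrix.of fun i j => signedPow r (z i j)).det ≠ 0 := by
  set s : Set (Fin n → Fin n → ℝ) := {A | (Matrix.of A).det = 0 ∧ ∀ i j, A i j ≠ 0}
  have hs : volume s = 0 :=
    measure_mono_null (fun A hA => not_not.2 hA.1) (ae_iff.1 (ae_det_ne_zero n))
  have hd : DifferentiableOn ℝ
      (fun (A : Fin n → Fin n → ℝ) i j => signedPow r⁻¹ (A i j)) s := by
    intro A hA
    refine DifferentiableAt.differentiableWithinAt ?_
    refine differentiableAt_pi.2 fun i => differentiableAt_pi.2 fun j => ?_
    exact DifferentiableAt.comp (𝕜 := ℝ) (f := fun A : Fin n → Fin n → ℝ => A i j) A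
      (differentiableAt_signedPow (hA.2 i j)) (by fun_prop)
  have himage := addHaar_image_eq_zero_of_differentiableOn_of_addHaar_eq_zero volume hd hs
  filter_upwards [measure_eq_zero_iff_ae_notMem.1 himage, ae_entries_ne_zero n] with z hz hne hdet
  refine hz ⟨fun i j => signedPow r (z i j), ⟨hdet, fun i j => signedPow_ne_zero (hne i j)⟩, ?_⟩
  ext i j
  exact signedPow_inv_signedPow hr (hne i j)

/-- The linear involution of `(ℝ^n)^n` replacing each `x j` with `j ≠ i` by `x i - x j`. -/
def diffFrom {n : ℕ} (i : Fin n) : (Fin n → Fin n → ℝ) →ₗ[ℝ] (Fin n → Fin n → ℝ) where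
  toFun x j := if j = i then x i else x i - x j
  map_add' x y := by
    ext j k
    dsimp only [Pi.add_apply]
    split_ifs <;> simp [add_sub_add_comm]
  map_smul' c x := by
    ext j k
    dsimp only [Pi.smul_apply]
    split_ifs <;> simp [mul_sub]

theorem diffFrom_of_ne {n : ℕ} {i j : Fin n} (h : j ≠ i) (x : Fin n → Fin n → ℝ) :
    diffFrom i x j = x i - x j :=
  if_neg h

theorem diffFrom_self {n : ℕ} (i : Fin n) (x : Fin n → Fin n → ℝ) :
    diffFrom i x i = x i :=
  if_pos rfl

theorem diffFrom_involutive {n : ℕ} (i : Fin n) : Function.Involutive (diffFrom i) := by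
  intro x
  funext j
  by_cases h : j = i
  · subst h
    rw [diffFrom_self, diffFrom_self]
  · rw [diffFrom_of_ne h, diffFrom_self, diffFrom_of_ne h, sub_sub_cancel]

theorem ae_det_signedPow_diffFrom_ne_zero {r : ℝ} (hr : r ≠ 0) (n : ℕ) :
    ∀ᵐ x : Fin n → Fin n → ℝ ∂volume, ∀ i,
      (Matrix.of fun j k => signedPow r (diffFrom i x j k)).det ≠ 0 := by
  rw [ae_all_iff]
  intro i
  have hdet : LinearMap.det (diffFrom i) ≠ 0 :=
    (LinearEquiv.isUnit_det' (LinearEquiv.ofInvolutive _ (diffFrom_involutive i))).ne_zero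
  exact (Measure.LinearMap.quasiMeasurePreserving volume _ hdet).ae (ae_det_signedPow_ne_zero hr n)

theorem contDiff_Fmap {p : ℝ} (hp : 1 < p) (n : ℕ) : ContDiff ℝ 1 (Fmap p n) := by
  refine contDiff_pi.2 fun q => ContDiff.sum fun k _ => ?_
  exact ContDiff.norm_rpow (f := fun x : Fin n → Fin n → ℝ => x q.val.1 k - x q.val.2 k)
    (by fun_prop) hp

theorem fderiv_Fmap_apply {p : ℝ} (hp : 1 < p) {n : ℕ} (x h : Fin n → Fin n → ℝ)
    (q : PairIdx n) :
    fderiv ℝ (Fmap p n) x h q = ∑ k, p * signedPow (p - 1) (x q.val.1 k - x q.val.2 k) *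
      (h q.val.1 k - h q.val.2 k) := by
  have hx : x + (0 : ℝ) • h = x := by simp
  have hF : HasFDerivAt (Fmap p n) (fderiv ℝ (Fmap p n) x) (x + (0 : ℝ) • h) := by
    rw [hx]
    exact ((contDiff_Fmap hp n).differentiable one_ne_zero x).hasFDerivAt
  have hl : HasDerivAt (fun t : ℝ => x + t • h) h 0 := by
    simpa using ((hasDerivAt_id (0 : ℝ)).smul_const h).const_add x
  refine (hasDerivAt_pi.1 (hF.comp_hasDerivAt (0 : ℝ) hl) q).unique ?_
  change HasDerivAt (fun t : ℝ =>
    ∑ k, |(x + t • h) q.val.1 k - (x + t • h) q.val.2 k| ^ p) _ 0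
  refine HasDerivAt.fun_sum fun k _ => ?_
  have hsub := (hasDerivAt_pi.1 (hasDerivAt_pi.1 hl q.val.1) k).fun_sub
    (hasDerivAt_pi.1 (hasDerivAt_pi.1 hl q.val.2) k)
  have hpow : HasDerivAt (fun t : ℝ => |t| ^ p)
      (p * signedPow (p - 1) (x q.val.1 k - x q.val.2 k))
      ((x + (0 : ℝ) • h) q.val.1 k - (x + (0 : ℝ) • h) q.val.2 k) := by
    rw [hx]
    convert hasDerivAt_abs_rpow (x q.val.1 k - x q.val.2 k) hp using 1
    rw [signedPow, mul_assoc]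
    ring_nf
  exact hpow.comp (0 : ℝ) hsub

/-- If for each `i` the matrix with rows given by signed powers of the differences `x i - x j` is
invertible, then `Fmap` is a submersion at `x`. -/
theorem surjective_fderiv_Fmap {p : ℝ} (hp : 1 < p) {n : ℕ} {x : Fin n → Fin n → ℝ}
    (hx : ∀ i, (Matrix.of fun j k => signedPow (p - 1) (diffFrom i x j k)).det ≠ 0) :
    Function.Surjective (fderiv ℝ (Fmap p n) x) := by
  intro c
  have hsolve : ∀ i, ∃ v : Fin n → ℝ, ∀ j, ∑ k, signedPow (p - 1) (diffFrom i x j k) * v k =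
      if hij : i < j then p⁻¹ * c ⟨(i, j), hij⟩ else 0 := by
    intro i
    obtain ⟨v, hv⟩ := (Matrix.mulVec_surjective_iff_isUnit.2
      ((Matrix.isUnit_iff_isUnit_det _).2 (hx i).isUnit))
      (fun j => if hij : i < j then p⁻¹ * c ⟨(i, j), hij⟩ else 0)
    exact ⟨v, congrFun hv⟩
  choose h hh using hsolve
  refine ⟨h, ?_⟩
  ext ⟨⟨i, j⟩, hij⟩
  rw [fderiv_Fmap_apply hp]
  have h₁ := hh i j
  have h₂ := hh j i
  rw [dif_pos hij, diffFrom_of_ne hij.ne'] at h₁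
  rw [dif_neg hij.not_gt, diffFrom_of_ne hij.ne, ← neg_sub (x i)] at h₂
  simp only [Pi.sub_apply, Pi.neg_apply, signedPow_neg] at h₁ h₂
  have hp0 : p ≠ 0 := by positivity
  calc ∑ k, p * signedPow (p - 1) (x i k - x j k) * (h i k - h j k)
      = p * (∑ k, signedPow (p - 1) (x i k - x j k) * h i k +
          ∑ k, -signedPow (p - 1) (x i k - x j k) * h j k) := by
        rw [← Finset.sum_add_distrib, Finset.mul_sum]
        exact Finset.sum_congr rfl fun k _ => by ring
    _ = c ⟨(i, j), hij⟩ := by rw [h₁, h₂, add_zero, mul_inv_cancel_left₀ hp0]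

theorem pNorm_nonneg (p : ℝ) {n : ℕ} (v : Fin n → ℝ) : 0 ≤ pNorm p v :=
  Real.rpow_nonneg (Finset.sum_nonneg fun _ _ => Real.rpow_nonneg (abs_nonneg _) _) _

theorem pNorm_rpow {p : ℝ} (hp : p ≠ 0) {n : ℕ} (v : Fin n → ℝ) :
    pNorm p v ^ p = ∑ k, |v k| ^ p := by
  rw [pNorm, one_div, Real.rpow_inv_rpow _ hp]
  exact Finset.sum_nonneg fun _ _ => Real.rpow_nonneg (abs_nonneg _) _

theorem pNorm_zero {p : ℝ} (hp : p ≠ 0) {n : ℕ} : pNorm p (0 : Fin n → ℝ) = 0 := by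
  simp [pNorm, Real.zero_rpow hp, Real.zero_rpow (inv_ne_zero hp)]

theorem pNorm_sub_comm (p : ℝ) {n : ℕ} (v w : Fin n → ℝ) : pNorm p (v - w) = pNorm p (w - v) := by
  simp [pNorm, abs_sub_comm]

/-- If `Fmap` is a submersion at `x`, then all families of nonnegative numbers close to the
distances `‖x i - x j‖_p` are realized by points of `ℓ_p^n`. -/
theorem exists_forall_pNorm_sub_eq {p : ℝ} (hp : 1 < p) {n : ℕ} {x : Fin n → Fin n → ℝ}
    (hx : Function.Surjective (fderiv ℝ (Fmap p n) x)) :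
    ∃ ε > (0 : ℝ), ∀ d : PairIdx n → ℝ, (∀ q, 0 ≤ d q) →
      (∀ q, |d q - pNorm p (x q.val.1 - x q.val.2)| < ε) →
      ∃ f : Fin n → Fin n → ℝ, ∀ q : PairIdx n, pNorm p (f q.val.1 - f q.val.2) = d q := by
  have hp0 : p ≠ 0 := by positivity
  have hstrict := (contDiff_Fmap hp n).contDiffAt.hasStrictFDerivAt (x := x) one_ne_zero
  have hmap := hstrict.map_nhds_eq_of_surj (LinearMap.range_eq_top.2 hx)
  have hrange : Set.range (Fmap p n) ∈ nhds (Fmap p n x) := by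
    rw [← hmap]
    exact Filter.range_mem_map
  let D : PairIdx n → ℝ := fun q => pNorm p (x q.val.1 - x q.val.2)
  have hD : (fun q => D q ^ p) = Fmap p n x := funext fun q => pNorm_rpow hp0 _
  have hcont : Continuous fun (d : PairIdx n → ℝ) q => d q ^ p :=
    continuous_pi fun q => (continuous_apply q).rpow_const fun _ => Or.inr (by positivity)
  obtain ⟨ε, hε, hball⟩ := Metric.mem_nhds_iff.1
    (hcont.continuousAt.preimage_mem_nhds (hD ▸ hrange : _ ∈ nhds (fun q => D q ^ p)))
  refine ⟨ε, hε, fun d hd0 hd => ?_⟩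
  obtain ⟨f, hf⟩ := hball ((dist_pi_lt_iff hε).2 hd)
  refine ⟨f, fun q => ?_⟩
  have hq : pNorm p (f q.val.1 - f q.val.2) ^ p = d q ^ p :=
    (pNorm_rpow hp0 _).trans (congrFun hf q)
  exact (Real.rpow_left_inj (pNorm_nonneg _ _) (hd0 q) hp0).1 hq

/-- For almost every `n`-tuple `x` in `(ℝ^n)^n` there is `ε > 0` such
that every metric space on `n` points that is an `ε`-perturbation of
`{x₁,…,xₙ} ⊆ ℓ_p^n` embeds isometrically into `ℓ_p^n`. -/
theorem stmt1 (p : ℝ) (hp : 1 < p) (n : ℕ) :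
    ∀ᵐ x : Fin n → Fin n → ℝ ∂volume, ∃ ε > (0 : ℝ),
      ∀ (Y : Type) [MetricSpace Y] (y : Fin n → Y),
        (∀ i j, |dist (y i) (y j) - pNorm p (x i - x j)| < ε) →
        ∃ f : Fin n → Fin n → ℝ, ∀ i j, pNorm p (f i - f j) = dist (y i) (y j) := by
  have hp0 : p ≠ 0 := by positivity
  filter_upwards [ae_det_signedPow_diffFrom_ne_zero (sub_pos.2 hp).ne' n] with x hx
  obtain ⟨ε, hε, h⟩ := exists_forall_pNorm_sub_eq hp (surjective_fderiv_Fmap hp hx)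
  refine ⟨ε, hε, fun Y _ y hy => ?_⟩
  obtain ⟨f, hf⟩ := h (fun q => dist (y q.val.1) (y q.val.2)) (fun q => dist_nonneg)
    fun q => hy q.val.1 q.val.2
  refine ⟨f, fun i j => ?_⟩
  rcases lt_trichotomy i j with hij | rfl | hij
  · exact hf ⟨(i, j), hij⟩
  · rw [sub_self, pNorm_zero hp0, dist_self]
  · rw [pNorm_sub_comm, dist_comm]
    exact hf ⟨(j, i), hij⟩
end
end

section
/- Fix n ∈ ℕ and 1 < p < ∞. Let H = {(x_1,…,x_n) ∈ M_n : x_i = e_i + Σ_{j=i+1}^n x_i^j e_j for each i = 1,…,n}, where e_1,…,e_n is the standard basis of ℝ^n. If x ∈ H, then the partial derivatives ∂F_n/∂e_l^k(x), taken over all pairs 1 ≤ k < l ≤ n, are linearly independent vectors in ℝ^{n(n−1)/2}. In particular H ⊆ G_n. -/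
open MeasureTheory
open scoped ENNReal
noncomputable section

-- test lp coercion and instances

theorem card_pairIdx (n : ℕ) : Fintype.card (PairIdx n) = n * (n - 1) / 2 := by
  rw [Fintype.card_subtype, Finset.card_filter, Fintype.sum_prod_type_right,
    ← Finset.sum_range_id, ← Fin.sum_univ_eq_sum_range (fun i => i)]
  refine Finset.sum_congr rfl fun j _ => ?_
  rw [← Finset.card_filter, Finset.filter_gt_eq_Iio, Fin.card_Iio]

theorem hasFDerivAt_Fmap {p : ℝ} (hp : 1 < p) (n : ℕ) (x : Fin n → Fin n → ℝ) :
    HasFDerivAt (Fmap p n) (ContinuousLinearMap.pi fun q : PairIdx n => ∑ k,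
      (p * |x q.val.1 k - x q.val.2 k| ^ (p - 2) * (x q.val.1 k - x q.val.2 k)) •
        ((ContinuousLinearMap.proj (R := ℝ) (φ := fun _ : Fin n => ℝ) k).comp
            (ContinuousLinearMap.proj (R := ℝ) (φ := fun _ : Fin n => Fin n → ℝ) q.val.1) -
          (ContinuousLinearMap.proj (R := ℝ) (φ := fun _ : Fin n => ℝ) k).comp
            (ContinuousLinearMap.proj (R := ℝ) (φ := fun _ : Fin n => Fin n → ℝ) q.val.2))) x := by
  refine hasFDerivAt_pi.2 fun q => HasFDerivAt.fun_sum fun k _ => ?_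
  exact (hasDerivAt_abs_rpow (x q.val.1 k - x q.val.2 k) hp).comp_hasFDerivAt x
    (ContinuousLinearMap.hasFDerivAt
      ((ContinuousLinearMap.proj (R := ℝ) (φ := fun _ : Fin n => ℝ) k).comp
          (ContinuousLinearMap.proj (R := ℝ) (φ := fun _ : Fin n => Fin n → ℝ) q.val.1) -
        (ContinuousLinearMap.proj (R := ℝ) (φ := fun _ : Fin n => ℝ) k).comp
          (ContinuousLinearMap.proj (R := ℝ) (φ := fun _ : Fin n => Fin n → ℝ) q.val.2)))

theorem fderiv_Fmap_single {p : ℝ} (hp : 1 < p) (n : ℕ) (x : Fin n → Fin n → ℝ)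
    (l k : Fin n) (q : PairIdx n) :
    fderiv ℝ (Fmap p n) x (Pi.single l (Pi.single k (1 : ℝ))) q =
      p * |x q.val.1 k - x q.val.2 k| ^ (p - 2) * (x q.val.1 k - x q.val.2 k) *
        ((if q.val.1 = l then 1 else 0) - (if q.val.2 = l then 1 else 0)) := by
  have single_apply (m j : Fin n) :
      (Pi.single l (Pi.single k (1 : ℝ)) : Fin n → Fin n → ℝ) m j =
        if j = k then (if m = l then 1 else 0) else 0 := by
    by_cases hm : m = l <;> by_cases hj : j = k <;> simp [hm, hj]
  rw [(hasFDerivAt_Fmap hp n x).fderiv]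
  simp only [ContinuousLinearMap.pi_apply, sum_apply,
    smul_apply, sub_apply,
    ContinuousLinearMap.comp_apply, ContinuousLinearMap.proj_apply, single_apply, smul_eq_mul]
  rw [Finset.sum_eq_single k (fun j _ hj => by simp [hj]) (by simp)]
  simp

/-- A family indexed by pairs is linearly independent if its matrix has nonzero diagonal entries
and its entry at `((k, l), (i, j)) ≠ ((k, l), (k, l))` vanishes unless `l = j` and `i ≤ k`. -/
theorem linearIndependent_of_triangular {n : ℕ} (v : PairIdx n → PairIdx n → ℝ)
    (hdiag : ∀ q, v q q ≠ 0)
    (hzero : ∀ q r, r ≠ q → (q.val.2 = r.val.2 → q.val.1 < r.val.1) → v q r = 0) :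
    LinearIndependent ℝ v := by
  rw [Fintype.linearIndependent_iff]
  intro c hc q
  induction h : n - q.val.1.val using Nat.strong_induction_on generalizing q with
  | _ m ih =>
    have hq := congrFun hc q
    rw [Finset.sum_apply, Finset.sum_eq_single q] at hq
    · simpa [hdiag q] using hq
    · intro r _ hr
      by_cases hlt : q.val.1 < r.val.1
      · have := ih (n - r.val.1.val) (by have := r.val.1.isLt; omega) r rfl
        simp [this]
      · have : v r q = 0 := by
          refine hzero r q hr.symm fun h2 => lt_of_le_of_ne (not_lt.1 hlt) fun h1 => ?_
          exact hr (Subtype.ext (Prod.ext h1 h2))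
        simp [this]
    · simp

/-- If `x ∈ H`, i.e. `x_i = e_i + ∑_{j>i} x_i^j e_j` for each `i`,
then the partial derivatives `∂F_n/∂e_l^k (x)`, `1 ≤ k < l ≤ n`, are linearly
independent; in particular `H ⊆ G_n`. (Here `e_l^k` has `e_k` in the `l`-th slot.) -/
theorem stmt3 (p : ℝ) (hp : 1 < p) (n : ℕ) (x : Fin n → Fin n → ℝ)
    (hx : ∀ i : Fin n, x i i = 1 ∧ ∀ j : Fin n, j < i → x i j = 0) :
    LinearIndependent ℝ (fun q : PairIdx n =>
      fderiv ℝ (Fmap p n) x (Pi.single q.val.2 (Pi.single q.val.1 (1 : ℝ)))) ∧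
    x ∈ Gset p n := by
  have hli : LinearIndependent ℝ (fun q : PairIdx n =>
      fderiv ℝ (Fmap p n) x (Pi.single q.val.2 (Pi.single q.val.1 (1 : ℝ)))) := by
    refine linearIndependent_of_triangular _ (fun q => ?_) fun q r hrq hlt => ?_
    · rw [fderiv_Fmap_single hp, (hx q.val.1).1, (hx q.val.2).2 _ q.prop]
      simpa [q.prop.ne] using (zero_lt_one.trans hp).ne'
    · rw [fderiv_Fmap_single hp]
      by_cases h2 : r.val.2 = q.val.2
      · have hr : q.val.1 < r.val.1 := hlt h2.symm
        simp [(hx r.val.1).2 _ hr, (hx r.val.2).2 _ (hr.trans r.prop)]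
      · by_cases h1 : r.val.1 = q.val.2
        · have hr : q.val.1 < r.val.1 := h1 ▸ q.prop
          simp [(hx r.val.1).2 _ hr, (hx r.val.2).2 _ (hr.trans r.prop)]
        · simp [h1, h2]
  refine ⟨hli, ?_⟩
  have hspan := hli.span_eq_top_of_card_eq_finrank' (by simp)
  have hsurj : LinearMap.range (fderiv ℝ (Fmap p n) x).toLinearMap = ⊤ := by
    rw [eq_top_iff, ← hspan, Submodule.span_le]
    rintro _ ⟨q, rfl⟩
    exact ⟨_, rfl⟩
  change LinearMap.rank _ = _
  rw [LinearMap.rank, hsurj, rank_top, rank_fun', card_pairIdx]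
end
end

section
/- Fix n ∈ ℕ and 1 < p < ∞. Let V = {(x_1,…,x_n) ∈ M_n : there exist i ≠ j and k with x_i^k = x_j^k}. Suppose x = (x_1,…,x_n) and y = (y_1,…,y_n) lie in the same connected component of M_n \ V, and suppose the partial derivatives ∂F_n/∂e_i^j(x), 1 ≤ i < j ≤ n, are linearly independent. Then for all but finitely many t ∈ [0,1], the partial derivatives ∂F_n/∂e_i^j((1−t)x + ty), 1 ≤ i < j ≤ n, are linearly independent; in particular, (1−t)x + ty ∈ G_n for all but finitely many t ∈ [0,1]. -/
open MeasureTheory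
open scoped ENNReal
noncomputable section

theorem contDiffAt_abs_rpow (p : ℝ) {u : ℝ} (hu : u ≠ 0) {n : WithTop ℕ∞} :
    ContDiffAt ℝ n (fun u => |u| ^ p) u := by
  have h (u : ℝ) : |u| ^ p = (u ^ 2) ^ (p / 2) := by
    rw [← sq_abs, ← Real.rpow_natCast_mul (abs_nonneg u)]
    congr 1
    push_cast
    ring
  simp_rw [h]
  exact (contDiffAt_id.pow 2).rpow_const_of_ne (pow_ne_zero 2 hu)

theorem analyticAt_Fmap (p : ℝ) {n : ℕ} {z : Fin n → Fin n → ℝ}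
    (hz : ∀ i j k, i ≠ j → z i k ≠ z j k) : AnalyticAt ℝ (Fmap p n) z := by
  refine ContDiffAt.analyticAt (contDiffAt_pi.2 fun q => ContDiffAt.sum fun k _ => ?_)
  have hsub : ContDiffAt ℝ ⊤ (fun z : Fin n → Fin n → ℝ => z q.val.1 k - z q.val.2 k) z := by
    fun_prop
  exact (contDiffAt_abs_rpow p (sub_ne_zero.2 (hz _ _ _ q.2.ne))).comp z hsub

theorem segment_ne_of_mem_connectedComponentIn {ι κ : Type*} {x y : ι → κ → ℝ}
    (hxy : y ∈ connectedComponentIn {z : ι → κ → ℝ | ¬ ∃ i j k, i ≠ j ∧ z i k = z j k} x)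
    {t : ℝ} (ht : t ∈ Set.Icc (0 : ℝ) 1) (i j : ι) (k : κ) (hij : i ≠ j) :
    ((1 - t) • x + t • y) i k ≠ ((1 - t) • x + t • y) j k := by
  set S := {z : ι → κ → ℝ | ¬ ∃ i j k, i ≠ j ∧ z i k = z j k}
  have hxS : x ∈ S := connectedComponentIn_nonempty_iff.1 ⟨y, hxy⟩
  have hx : x ∈ connectedComponentIn S x := mem_connectedComponentIn hxS
  have hord : (Set.image (fun z : ι → κ → ℝ => z i k - z j k)
      (connectedComponentIn S x)).OrdConnected :=
    (isPreconnected_connectedComponentIn.image _ (by fun_prop)).ordConnected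
  have hseg := hord.convex (Set.mem_image_of_mem _ hx) (Set.mem_image_of_mem _ hxy)
    (sub_nonneg.2 ht.2) ht.1 (sub_add_cancel 1 t)
  obtain ⟨z, hz, hzt⟩ := hseg
  intro h
  refine connectedComponentIn_subset S x hz ⟨i, j, k, hij, ?_⟩
  simp only [Pi.add_apply, Pi.smul_apply, smul_eq_mul] at h hzt
  linarith

theorem mem_Gset_of_linearIndependent {p : ℝ} {n : ℕ} {z : Fin n → Fin n → ℝ}
    {v : PairIdx n → Fin n → Fin n → ℝ}
    (hz : LinearIndependent ℝ fun q => fderiv ℝ (Fmap p n) z (v q)) : z ∈ Gset p n := by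
  rw [Gset, Set.mem_ofPred_eq, ← card_pairIdx]
  refine le_antisymm ((LinearMap.rank_le_range _).trans_eq rank_fun') ?_
  have := LinearIndependent.cardinal_le_rank (R := ℝ)
    (M := (fderiv ℝ (Fmap p n) z).toLinearMap.range)
    (v := fun q => ⟨_, LinearMap.mem_range_self _ (v q)⟩) (.of_comp (Submodule.subtype _) hz)
  simpa using this

/-- If `x` and `y` lie in the same connected component of `Mₙ \ V` and
the partial derivatives `∂F_n/∂e_i^j (x)`, `i < j`, are linearly independent, then for
all but finitely many `t ∈ [0,1]` the partial derivatives at `(1-t)x + ty` are linearly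
independent; in particular `(1-t)x + ty ∈ G_n` for all but finitely many `t ∈ [0,1]`.
(Here `e_i^j` has `e_j` in the `i`-th slot.) -/
theorem stmt4 (p : ℝ) (hp : 1 < p) (n : ℕ) (x y : Fin n → Fin n → ℝ)
    (hxy : y ∈ connectedComponentIn
      {z : Fin n → Fin n → ℝ | ¬ ∃ i j k, i ≠ j ∧ z i k = z j k} x)
    (hx : LinearIndependent ℝ (fun q : PairIdx n =>
      fderiv ℝ (Fmap p n) x (Pi.single q.val.1 (Pi.single q.val.2 (1 : ℝ))))) :
    {t : ℝ | t ∈ Set.Icc (0 : ℝ) 1 ∧ ¬ LinearIndependent ℝ (fun q : PairIdx n =>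
      fderiv ℝ (Fmap p n) ((1 - t) • x + t • y)
        (Pi.single q.val.1 (Pi.single q.val.2 (1 : ℝ))))}.Finite ∧
    {t : ℝ | t ∈ Set.Icc (0 : ℝ) 1 ∧ (1 - t) • x + t • y ∉ Gset p n}.Finite := by
  let D : ℝ → Matrix (PairIdx n) (PairIdx n) ℝ := fun t => .of fun q =>
    fderiv ℝ (Fmap p n) ((1 - t) • x + t • y) (Pi.single q.val.1 (Pi.single q.val.2 (1 : ℝ)))
  have hD (t : ℝ) : LinearIndependent ℝ (fun q : PairIdx n =>
      fderiv ℝ (Fmap p n) ((1 - t) • x + t • y)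
        (Pi.single q.val.1 (Pi.single q.val.2 (1 : ℝ)))) ↔ (D t).det ≠ 0 := by
    rw [← isUnit_iff_ne_zero, ← Matrix.isUnit_iff_isUnit_det,
      ← Matrix.linearIndependent_rows_iff_isUnit]
    rfl
  have han : AnalyticOnNhd ℝ (fun t => (D t).det) (Set.Icc 0 1) := by
    intro t ht
    have hline : AnalyticAt ℝ (fun s : ℝ => (1 - s) • x + s • y) t := by fun_prop
    have hderiv := (analyticAt_Fmap p (segment_ne_of_mem_connectedComponentIn hxy ht)).fderiv.comp
      (f := fun s : ℝ => (1 - s) • x + s • y) hline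
    have hentry (q r : PairIdx n) : AnalyticAt ℝ (fun s => D s q r) t :=
      (((ContinuousLinearMap.proj r : (PairIdx n → ℝ) →L[ℝ] ℝ).comp
        (ContinuousLinearMap.apply ℝ (PairIdx n → ℝ)
          (Pi.single q.val.1 (Pi.single q.val.2 (1 : ℝ)) : Fin n → Fin n → ℝ))).analyticAt _).comp
        hderiv
    simp only [Matrix.det_apply']
    exact Finset.analyticAt_fun_sum _ fun σ _ =>
      analyticAt_const.mul (Finset.analyticAt_fun_prod _ fun i _ => hentry (σ i) i)
  have hfin : {t : ℝ | t ∈ Set.Icc (0 : ℝ) 1 ∧ ¬ LinearIndependent ℝ (fun q : PairIdx n =>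
      fderiv ℝ (Fmap p n) ((1 - t) • x + t • y)
        (Pi.single q.val.1 (Pi.single q.val.2 (1 : ℝ))))}.Finite := by
    have h0 : (D 0).det ≠ 0 := (hD 0).1 (by simpa using hx)
    rcases han.eqOn_zero_or_eventually_ne_zero_of_preconnected isPreconnected_Icc with h | h
    · exact absurd (h (Set.left_mem_Icc.2 zero_le_one)) h0
    · refine (isCompact_Icc.finite_sdiff_of_mem_codiscreteWithin h).subset fun t ht => ?_
      exact ⟨ht.1, fun h => ht.2 ((hD t).2 h)⟩
  exact ⟨hfin, hfin.subset fun t ht => ⟨ht.1, fun h => ht.2 (mem_Gset_of_linearIndependent h)⟩⟩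
end
end
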